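/- arXiv:1707.00213 — 2 statements merged into one kernel-verified Lean document; each statement's English description precedes it below -/
import Mathlib

section
/- Let F be a field, K1 and K2 quadratic étale F-algebras with nontrivial automorphisms σ1, σ2, and let K = K1 ⊗_F K2 with the automorphism τ3 given by (x ⊗ y)^{τ3} = x^{σ1} ⊗ y^{σ2}; let K3 ⊂ K be the fixed subalgebra of τ3. Given a quaternion algebra B over F with embeddings α1 : K1 → B and α2 : K2 → B, define α : K → B by α(x ⊗ y) = α1(x)α2(y). Then there exists a unique ξ ∈ K3 such that Nrd_B(α(x)) = Tr_{K3/F}(ξ · x · x^{τ3}) for all x ∈ K. This ξ satisfies Tr_{K3/F}(ξ) = 1, and moreover Trd_B(α(x)α(y)^ι) = Tr_{K/F}(ξ · x · y^{τ3}) for all x, y ∈ K. -/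
open scoped TensorProduct

theorem quad_trace {R C : Type*} [CommRing R] [CommRing C] [Algebra R C]
    (s : C →+* C) (hs : ∀ x, s (s x) = x)
    (hinj : Function.Injective (algebraMap R C))
    (hfix : ∀ x, s x = x ↔ ∃ r, algebraMap R C r = x)
    (a : C) (ha : IsUnit (a - s a)) :
    Nonempty (Module.Basis (Fin 2) R C) ∧
      ∀ z, algebraMap R C (Algebra.trace R C z) = z + s z := by
  obtain ⟨u, hu⟩ := ha
  set v : C := ((u⁻¹ : Cˣ) : C) with hv
  have huv : (a - s a) * v = 1 := by rw [← hu]; simp [hv]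
  have hsv : s v = - v := by
    have h1 : (s a - a) * s v = 1 := by
      have := congrArg s huv
      simpa [hs] using this
    linear_combination (-v) * h1 - (s v) * huv
  have hsc : ∀ r : R, s (algebraMap R C r) = algebraMap R C r := fun r => (hfix _).2 ⟨r, rfl⟩
  have hq : ∀ x, ∃ r, algebraMap R C r = (x - s x) * v := fun x =>
    (hfix _).1 (by rw [map_mul, map_sub, hs, hsv]; ring)
  have hp : ∀ x, ∃ r, algebraMap R C r = x - (x - s x) * v * a := fun x =>
    (hfix _).1 (by
      simp only [map_mul, map_sub, hs, hsv]
      linear_combination (x - s x) * huv)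
  choose q hq using hq
  choose p hp using hp
  let E : C ≃ₗ[R] (Fin 2 → R) :=
    { toFun := fun x => ![p x, q x]
      invFun := fun w => algebraMap R C (w 0) + algebraMap R C (w 1) * a
      map_add' := by
        intro x y
        ext i
        fin_cases i
        · apply hinj; simp [hp]; ring
        · apply hinj; simp [hq]; ring
      map_smul' := by
        intro r x
        ext i
        fin_cases i
        · apply hinj; simp [hp, Algebra.smul_def, hsc]; ring
        · apply hinj; simp [hq, Algebra.smul_def, hsc]; ring
      left_inv := by
        intro x
        simp [hp, hq]
      right_inv := by
        intro w
        ext i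
        fin_cases i
        · apply hinj
          simp [hp, hsc]
          linear_combination (-(algebraMap R C (w 1)) * a) * huv
        · apply hinj
          simp [hq, hsc]
          linear_combination (algebraMap R C (w 1)) * huv }
  let b := Module.Basis.ofEquivFun E
  have hb0 : b 0 = 1 := by
    simp [b, Module.Basis.coe_ofEquivFun, E]
  have hb1 : b 1 = a := by
    simp [b, Module.Basis.coe_ofEquivFun, E]
  refine ⟨⟨b⟩, fun z => ?_⟩
  rw [Algebra.trace_eq_matrix_trace b, Matrix.trace_fin_two,
    Algebra.leftMulMatrix_eq_repr_mul, Algebra.leftMulMatrix_eq_repr_mul, hb0, hb1]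
  have e0 : b.repr (z * 1) 0 = p (z * 1) := rfl
  have e1 : b.repr (z * a) 1 = q (z * a) := rfl
  rw [e0, e1, map_add, hp, hq]
  simp only [mul_one, map_mul]
  linear_combination (s z) * huv

theorem quad_facts {F K : Type*} [Field F] [CommRing K] [Algebra F K] [Algebra.Etale F K]
    (hK : Module.finrank F K = 2) (σ : K ≃ₐ[F] K) (hσ : Function.Involutive σ)
    (hne : σ ≠ AlgEquiv.refl) :
    (∀ x, σ x = x ↔ ∃ r, algebraMap F K r = x) ∧ (∃ a, IsUnit (a - σ a)) ∧
      ∃ e, e + σ e = 1 := by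
  have hfd : Module.Finite F K := Module.finite_of_finrank_pos (by omega)
  have hnt : Nontrivial K := Module.nontrivial_of_finrank_pos (R := F) (by omega)
  have hred : IsReduced K := Algebra.FormallyUnramified.isReduced_of_field F K
  obtain ⟨a, ha⟩ : ∃ a, σ a ≠ a := by
    by_contra! h
    exact hne (AlgEquiv.ext h)
  have hfix : ∀ x, σ x = x ↔ ∃ r, algebraMap F K r = x := by
    intro x
    constructor
    · intro hx
      let S : Subalgebra F K := AlgHom.equalizer (σ : K →ₐ[F] K) (AlgHom.id F K)
      have hlt : Module.finrank F S < 2 := by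
        rw [← hK]
        refine Submodule.finrank_lt (s := Subalgebra.toSubmodule S) ?_
        intro h
        apply ha
        have : a ∈ Subalgebra.toSubmodule S := by rw [h]; trivial
        exact this
      have hpos : 0 < Module.finrank F S := Module.finrank_pos
      have hbot : S = ⊥ := Subalgebra.eq_bot_of_finrank_one (by omega)
      have hxS : x ∈ S := hx
      rw [hbot] at hxS
      exact Algebra.mem_bot.1 hxS
    · rintro ⟨r, rfl⟩
      exact σ.commutes r
  refine ⟨hfix, ⟨a, ?_⟩, ?_⟩
  · obtain ⟨c, hc⟩ := (hfix ((a - σ a) * (a - σ a))).1 (by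
      rw [map_mul, map_sub, hσ a]; ring)
    have hc0 : c ≠ 0 := by
      rintro rfl
      rw [map_zero] at hc
      have h0 : a - σ a = 0 := by
        have : IsNilpotent (a - σ a) := ⟨2, by rw [pow_two, ← hc]⟩
        exact this.eq_zero
      exact ha (sub_eq_zero.1 h0).symm
    have : IsUnit ((a - σ a) * (a - σ a)) := by
      rw [← hc]
      exact (IsUnit.mk0 c hc0).map _
    exact isUnit_of_mul_isUnit_left this
  · have : ∃ x, x + σ x ≠ 0 := by
      by_contra! h
      have h1 := h 1
      rw [map_one] at h1
      apply ha
      linear_combination h a - a * h1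
    obtain ⟨x, hx⟩ := this
    obtain ⟨c, hc⟩ := (hfix (x + σ x)).1 (by rw [map_add, hσ x]; ring)
    have hc0 : c ≠ 0 := by
      rintro rfl
      exact hx (by rw [← hc, map_zero])
    refine ⟨c⁻¹ • x, ?_⟩
    rw [map_smul, ← smul_add, ← hc, Algebra.smul_def, ← map_mul, inv_mul_cancel₀ hc0, map_one]

theorem conj_compat {F K B : Type*} [Field F] [CommRing K] [Algebra F K] [Ring B] [Algebra F B]
    [Nontrivial B]
    (σ : K ≃ₐ[F] K) (hσ : Function.Involutive σ)
    (hfix : ∀ x, σ x = x ↔ ∃ r, algebraMap F K r = x)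
    (ι : B → B) (Nrd Trd : B → F)
    (hι_alg : ∀ c : F, ι (algebraMap F B c) = algebraMap F B c)
    (hNrd : ∀ b : B, algebraMap F B (Nrd b) = b * ι b)
    (hTrd : ∀ b : B, algebraMap F B (Trd b) = b + ι b)
    (f : K →ₐ[F] B) (hf : Function.Injective f) (x : K) : ι (f x) = f (σ x) := by
  by_cases hx : ∃ r, algebraMap F K r = x
  · obtain ⟨r, rfl⟩ := hx
    simp [hι_alg]
  obtain ⟨t, ht⟩ := (hfix (x + σ x)).1 (by rw [map_add, hσ x]; ring)
  obtain ⟨n, hn⟩ := (hfix (x * σ x)).1 (by rw [map_mul, hσ x]; ring)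
  have ht' : algebraMap F B t = f x + f (σ x) := by rw [← map_add, ← ht, AlgHom.commutes]
  have hn' : algebraMap F B n = f x * f (σ x) := by rw [← map_mul, ← hn, AlgHom.commutes]
  have h1 := hTrd (f x)
  have h2 := hNrd (f x)
  have e1 : ι (f x) = algebraMap F B (Trd (f x)) - f x := by rw [h1]; abel
  have e2 : f (σ x) = algebraMap F B t - f x := by rw [ht']; abel
  have key : f x * algebraMap F B (Trd (f x) - t) = algebraMap F B (Nrd (f x) - n) := by
    rw [map_sub, map_sub, h2, hn', e1, e2]
    noncomm_ring
  by_cases h0 : Trd (f x) = t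
  · rw [e1, e2, h0]
  exfalso
  apply hx
  have h0' : Trd (f x) - t ≠ 0 := sub_ne_zero.2 h0
  refine ⟨(Nrd (f x) - n) * (Trd (f x) - t)⁻¹, hf ?_⟩
  rw [AlgHom.commutes, map_mul, ← key, mul_assoc, ← map_mul, mul_inv_cancel₀ h0', map_one, mul_one]

theorem tensor_nondeg {F K1 K2 : Type*} [Field F] [CommRing K1] [CommRing K2]
    [Algebra F K1] [Algebra F K2] [Module.Finite F K1] [Module.Finite F K2]
    (σ1 : K1 ≃ₐ[F] K1) (σ2 : K2 ≃ₐ[F] K2)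
    (h1 : ∀ z, algebraMap F K1 (Algebra.trace F K1 z) = z + σ1 z)
    (h2 : ∀ z, algebraMap F K2 (Algebra.trace F K2 z) = z + σ2 z)
    (a : K1) (ha : IsUnit (a - σ1 a)) (b : K2) (hb : IsUnit (b - σ2 b))
    (z : K1 ⊗[F] K2) (hz : ∀ w, Algebra.trace F (K1 ⊗[F] K2) (z * w) = 0) : z = 0 := by
  let T1 : (K1 ⊗[F] K2) ≃ₐ[F] (K1 ⊗[F] K2) := Algebra.TensorProduct.congr σ1 AlgEquiv.refl
  let T2 : (K1 ⊗[F] K2) ≃ₐ[F] (K1 ⊗[F] K2) := Algebra.TensorProduct.congr AlgEquiv.refl σ2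
  have htr : ∀ w, algebraMap F (K1 ⊗[F] K2) (Algebra.trace F (K1 ⊗[F] K2) w) =
      (w + T2 w) + T1 (w + T2 w) := by
    intro w
    induction w using TensorProduct.induction_on with
    | zero => simp
    | add x y hx hy => simp only [map_add, hx, hy]; ring
    | tmul x y =>
      have e : Algebra.trace F (K1 ⊗[F] K2) (x ⊗ₜ y) =
          Algebra.trace F K1 x * Algebra.trace F K2 y := by
        rw [Algebra.trace_apply, Algebra.trace_apply, Algebra.trace_apply,
          ← LinearMap.trace_tensorProduct']
        congr 1
        ext; simp
      have e2 : algebraMap F (K1 ⊗[F] K2) (Algebra.trace F K1 x * Algebra.trace F K2 y) =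
          (x + σ1 x) ⊗ₜ (y + σ2 y) := by
        rw [← h1, ← h2, map_mul, Algebra.TensorProduct.algebraMap_apply,
          Algebra.TensorProduct.algebraMap_apply']
        simp
      rw [e, e2]
      simp [T1, T2, TensorProduct.add_tmul, TensorProduct.tmul_add]
      abel
  have hA : IsUnit ((a ⊗ₜ[F] (1 : K2)) - T1 (a ⊗ₜ[F] (1 : K2))) := by
    have := ha.map (Algebra.TensorProduct.includeLeft : K1 →ₐ[F] K1 ⊗[F] K2)
    simpa [T1, TensorProduct.sub_tmul] using this
  have hB : IsUnit (((1 : K1) ⊗ₜ[F] b) - T2 ((1 : K1) ⊗ₜ[F] b)) := by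
    have := hb.map (Algebra.TensorProduct.includeRight : K2 →ₐ[F] K1 ⊗[F] K2)
    simpa [T2, TensorProduct.tmul_sub] using this
  have hAT : T2 (a ⊗ₜ[F] (1 : K2)) = a ⊗ₜ[F] (1 : K2) := by simp [T2]
  generalize a ⊗ₜ[F] (1 : K2) = A at *
  generalize (1 : K1) ⊗ₜ[F] b = B at *
  have hP : ∀ w, z * w + T2 (z * w) = 0 := by
    intro w
    have k1 := htr (z * w)
    have k2 := htr (z * (w * A))
    rw [hz, map_zero] at k1 k2
    simp only [map_mul, map_add, hAT] at k1 k2 ⊢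
    refine hA.mul_right_cancel ?_
    linear_combination (-k2) + (T1 A) * k1 
  have k1 := hP 1
  have k2 := hP B
  simp only [map_mul, map_one] at k1 k2
  refine hB.mul_right_cancel ?_
  linear_combination k2 - T2 B * k1

/-- Let `K1`, `K2` be quadratic étale `F`-algebras with nontrivial
automorphisms `σ1`, `σ2`, let `K = K1 ⊗[F] K2` with `τ3 = σ1 ⊗ σ2`, and let `K3 ⊆ K` be the
fixed subalgebra of `τ3`.  Given a quaternion algebra `B` over `F` (with main involution `ι`,
reduced norm `Nrd` and reduced trace `Trd`) and embeddings `α1 : K1 → B`, `α2 : K2 → B`, let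
`α : K → B` be the `F`-linear map `α (x ⊗ y) = α1 x * α2 y`.  Then there is a unique `ξ ∈ K3`
with `Nrd (α x) = Tr_{K3/F} (ξ * x * τ3 x)` for all `x ∈ K`; it satisfies
`Tr_{K3/F} ξ = 1` and `Trd (α x * (α y)^ι) = Tr_{K/F} (ξ * x * τ3 y)` for all `x, y ∈ K`. -/
theorem stmt1 (F : Type u) [Field F]
    (K1 K2 : Type u) [CommRing K1] [CommRing K2] [Algebra F K1] [Algebra F K2]
    [Algebra.Etale F K1] [Algebra.Etale F K2]
    (hK1 : Module.finrank F K1 = 2) (hK2 : Module.finrank F K2 = 2)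
    (σ1 : K1 ≃ₐ[F] K1) (σ2 : K2 ≃ₐ[F] K2)
    (hσ1 : Function.Involutive σ1) (hσ2 : Function.Involutive σ2)
    (hσ1ne : σ1 ≠ AlgEquiv.refl) (hσ2ne : σ2 ≠ AlgEquiv.refl)
    (B : Type u) [Ring B] [Algebra F B]
    [Algebra.IsCentral F B] [IsSimpleRing B] (hB : Module.finrank F B = 4)
    -- the main involution and the reduced norm and trace of `B`
    (ι : B → B) (Nrd Trd : B → F)
    (hι_add : ∀ a b : B, ι (a + b) = ι a + ι b)
    (hι_mul : ∀ a b : B, ι (a * b) = ι b * ι a)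
    (hι_inv : Function.Involutive ι)
    (hι_alg : ∀ c : F, ι (algebraMap F B c) = algebraMap F B c)
    (hNrd : ∀ b : B, algebraMap F B (Nrd b) = b * ι b)
    (hTrd : ∀ b : B, algebraMap F B (Trd b) = b + ι b)
    (α1 : K1 →ₐ[F] B) (α2 : K2 →ₐ[F] B)
    (hα1 : Function.Injective α1) (hα2 : Function.Injective α2)
    (α : K1 ⊗[F] K2 →ₗ[F] B)
    (hα : ∀ (x : K1) (y : K2), α (x ⊗ₜ[F] y) = α1 x * α2 y) :
    letI τ3 : (K1 ⊗[F] K2) ≃ₐ[F] (K1 ⊗[F] K2) := Algebra.TensorProduct.congr σ1 σ2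
    letI K3 : Subalgebra F (K1 ⊗[F] K2) :=
      AlgHom.equalizer (τ3 : (K1 ⊗[F] K2) →ₐ[F] (K1 ⊗[F] K2)) (AlgHom.id F (K1 ⊗[F] K2))
    (∃! ξ : K3,
        ∀ (x : K1 ⊗[F] K2) (h : (ξ : K1 ⊗[F] K2) * x * τ3 x ∈ K3),
          Nrd (α x) = Algebra.trace F K3 ⟨(ξ : K1 ⊗[F] K2) * x * τ3 x, h⟩) ∧
    ∀ ξ : K3,
      (∀ (x : K1 ⊗[F] K2) (h : (ξ : K1 ⊗[F] K2) * x * τ3 x ∈ K3),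
          Nrd (α x) = Algebra.trace F K3 ⟨(ξ : K1 ⊗[F] K2) * x * τ3 x, h⟩) →
      Algebra.trace F K3 ξ = 1 ∧
      ∀ x y : K1 ⊗[F] K2,
        Trd (α x * ι (α y)) =
          Algebra.trace F (K1 ⊗[F] K2) ((ξ : K1 ⊗[F] K2) * x * τ3 y) := by
  let τ3 : (K1 ⊗[F] K2) ≃ₐ[F] (K1 ⊗[F] K2) := Algebra.TensorProduct.congr σ1 σ2
  let K3 : Subalgebra F (K1 ⊗[F] K2) :=
      AlgHom.equalizer (τ3 : (K1 ⊗[F] K2) →ₐ[F] (K1 ⊗[F] K2)) (AlgHom.id F (K1 ⊗[F] K2))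
  have hfin1 : Module.Finite F K1 := Module.finite_of_finrank_pos (by omega)
  have hfin2 : Module.Finite F K2 := Module.finite_of_finrank_pos (by omega)
  obtain ⟨hfix1, ⟨a, ha⟩, ⟨e, he⟩⟩ := quad_facts hK1 σ1 hσ1 hσ1ne
  obtain ⟨hfix2, ⟨b, hb⟩, -⟩ := quad_facts hK2 σ2 hσ2 hσ2ne
  have hnt1 : Nontrivial K1 := Module.nontrivial_of_finrank_pos (R := F) (by omega)
  have hnt2 : Nontrivial K2 := Module.nontrivial_of_finrank_pos (R := F) (by omega)
  have hinjB : Function.Injective (algebraMap F B) := (algebraMap F B).injective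
  have htr1 := (quad_trace (σ1 : K1 →+* K1) hσ1 (algebraMap F K1).injective hfix1 a ha).2
  have htr2 := (quad_trace (σ2 : K2 →+* K2) hσ2 (algebraMap F K2).injective hfix2 b hb).2
  have hc1 := conj_compat σ1 hσ1 hfix1 ι Nrd Trd hι_alg hNrd hTrd α1 hα1
  have hc2 := conj_compat σ2 hσ2 hfix2 ι Nrd Trd hι_alg hNrd hTrd α2 hα2
  have hnd : ∀ z, (∀ w, Algebra.trace F (K1 ⊗[F] K2) (z * w) = 0) → z = 0 :=
    tensor_nondeg σ1 σ2 htr1 htr2 a ha b hb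
  have hττ : ∀ x, τ3 (τ3 x) = x := by
    intro x
    induction x using TensorProduct.induction_on with
    | zero => simp
    | add x y hx hy => simp only [map_add, hx, hy]
    | tmul x y => simp [τ3, hσ1 x, hσ2 y]
  have hmem : ∀ x, x ∈ K3 ↔ τ3 x = x := fun x => Iff.rfl
  have hτt : ∀ x y, τ3 (x ⊗ₜ y) = σ1 x ⊗ₜ σ2 y := fun x y => by simp [τ3]
  -- traces through `K3`
  have hA : IsUnit ((a ⊗ₜ[F] (1 : K2)) - τ3 (a ⊗ₜ[F] (1 : K2))) := by
    have := ha.map (Algebra.TensorProduct.includeLeft : K1 →ₐ[F] K1 ⊗[F] K2)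
    simpa [τ3, TensorProduct.sub_tmul] using this
  obtain ⟨⟨bs⟩, hq⟩ := quad_trace (R := K3) (τ3 : (K1 ⊗[F] K2) →+* (K1 ⊗[F] K2)) hττ
    Subtype.val_injective (fun x => ⟨fun h => ⟨⟨x, h⟩, rfl⟩, by rintro ⟨r, rfl⟩; exact r.2⟩)
    (a ⊗ₜ[F] (1 : K2)) hA
  have hT : ∀ z (h : z + τ3 z ∈ K3),
      Algebra.trace F (K1 ⊗[F] K2) z = Algebra.trace F K3 ⟨z + τ3 z, h⟩ := by
    intro z h
    have hfree : Module.Free K3 (K1 ⊗[F] K2) := Module.Free.of_basis bs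
    have hfin : Module.Finite K3 (K1 ⊗[F] K2) := Module.Finite.of_basis bs
    rw [← Algebra.trace_trace (S := K3)]
    congr 1
    exact Subtype.ext (hq z)
  have hmemT : ∀ z, z + τ3 z ∈ K3 := fun z => by
    rw [hmem, map_add, hττ, add_comm]
  have hmemN : ∀ (ξ : K3) x, (ξ : K1 ⊗[F] K2) * x * τ3 x ∈ K3 := fun ξ x => by
    rw [hmem, map_mul, map_mul, hττ, (hmem _).1 ξ.2]; ring
  -- properties of `Trd`, `Nrd`
  have hTadd : ∀ u v, Trd (u + v) = Trd u + Trd v := fun u v => hinjB (by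
    rw [map_add, hTrd, hTrd, hTrd, hι_add]; abel)
  have hTsmul : ∀ (c : F) u, Trd (c • u) = c * Trd u := fun c u => hinjB (by
    rw [map_mul, hTrd, hTrd, Algebra.smul_def, hι_mul, hι_alg, ← Algebra.commutes, mul_add])
  have hTι : ∀ u, Trd (ι u) = Trd u := fun u => hinjB (by
    rw [hTrd, hTrd, hι_inv u, add_comm])
  have hTcomm : ∀ u v, Trd (u * v) = Trd (v * u) := fun u v => by
    have h1 : Trd (u * v) = Trd (ι v * ι u) := by rw [← hι_mul, hTι]
    have eu : ι u = algebraMap F B (Trd u) - u := by rw [hTrd]; abel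
    have ev : ι v = algebraMap F B (Trd v) - v := by rw [hTrd]; abel
    apply hinjB
    rw [hTrd, hTrd, hι_mul, hι_mul, eu, ev]
    have c1 := Algebra.commutes (Trd u) v
    have c2 := Algebra.commutes (Trd v) u
    have c3 := Algebra.commutes (Trd u) (algebraMap F B (Trd v))
    simp only [mul_sub, sub_mul, c1, c2, c3]
    abel
  have hNadd : ∀ u v, Nrd (u + v) = Nrd u + Nrd v + Trd (u * ι v) := fun u v => hinjB (by
    rw [map_add, map_add, hNrd, hNrd, hNrd, hTrd, hι_mul, hι_inv, hι_add, add_mul, mul_add,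
      mul_add]
    abel)
  -- the linear functional
  let ℓ : K1 ⊗[F] K2 →ₗ[F] F :=
    { toFun := fun z => Trd (α z)
      map_add' := fun x y => by rw [map_add, hTadd]
      map_smul' := fun c x => by rw [map_smul, hTsmul]; rfl }
  have hℓ : ∀ z, ℓ z = Trd (α z) := fun z => rfl
  have hform : ∀ x y, Trd (α x * ι (α y)) = ℓ (x * τ3 y) := by
    have hι0 : ι 0 = 0 := by simpa using hι_alg 0
    have hT0 : Trd 0 = 0 := by simpa using hTsmul 0 0
    intro x y
    induction x using TensorProduct.induction_on with
    | zero => simp [hT0]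
    | add x x' hx hx' => rw [map_add, add_mul, hTadd, hx, hx', add_mul, map_add]
    | tmul x1 x2 =>
      induction y using TensorProduct.induction_on with
      | zero => simp [hι0, hT0]
      | add y y' hy hy' => rw [map_add, hι_add, mul_add, hTadd, hy, hy', map_add, mul_add, map_add]
      | tmul y1 y2 =>
        rw [hα, hα, hι_mul, hc1, hc2, hτt, Algebra.TensorProduct.tmul_mul_tmul, hℓ, hα,
          mul_comm x1, map_mul, map_mul, ← mul_assoc, hTcomm]
        simp only [mul_assoc]
  have hℓτ : ∀ z, ℓ (τ3 z) = ℓ z := by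
    intro z
    have h1 := hform 1 z
    rw [one_mul] at h1
    have hα1' : α 1 = 1 := by
      rw [Algebra.TensorProduct.one_def, hα, map_one, map_one, one_mul]
    rw [← h1, hα1', one_mul, hTι, hℓ]
  have hsym : (Algebra.traceForm F (K1 ⊗[F] K2)).Nondegenerate := by
    refine ⟨fun z hz => hnd z hz, fun z hz => hnd z fun w => ?_⟩
    rw [mul_comm]
    exact hz w
  obtain ⟨ξ0, hξ0⟩ : ∃ ξ0, ∀ z, ℓ z = Algebra.trace F (K1 ⊗[F] K2) (ξ0 * z) := by
    refine ⟨((Algebra.traceForm F (K1 ⊗[F] K2)).toDual hsym).symm ℓ, fun z => ?_⟩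
    exact (LinearMap.BilinForm.apply_toDual_symm_apply (hB := hsym) ℓ z).symm
  have hξ0mem : ξ0 ∈ K3 := by
    rw [hmem, ← sub_eq_zero]
    refine hnd _ fun w => ?_
    rw [sub_mul, map_sub, ← hξ0, ← hℓτ w]
    have : τ3 ξ0 * w = τ3 (ξ0 * τ3 w) := by rw [map_mul, hττ]
    rw [this, Algebra.trace_eq_of_algEquiv, ← hξ0, sub_self]
  -- the second part, for any `ξ`
  have hpol : ∀ ξ : K3, (∀ (x : K1 ⊗[F] K2) (h : (ξ : K1 ⊗[F] K2) * x * τ3 x ∈ K3),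
          Nrd (α x) = Algebra.trace F K3 ⟨(ξ : K1 ⊗[F] K2) * x * τ3 x, h⟩) →
      ∀ x y : K1 ⊗[F] K2, Trd (α x * ι (α y)) =
          Algebra.trace F (K1 ⊗[F] K2) ((ξ : K1 ⊗[F] K2) * x * τ3 y) := by
    intro ξ hξ x y
    have h1 := hNadd (α x) (α y)
    rw [← map_add, hξ _ (hmemN ξ _), hξ x (hmemN ξ _), hξ y (hmemN ξ _)] at h1
    rw [hT _ (hmemT _), eq_comm]
    rw [← sub_eq_iff_eq_add', ← map_add, ← map_sub] at h1
    rw [← h1]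
    congr 1
    apply Subtype.ext
    simp only [AddSubgroupClass.coe_sub, AddMemClass.coe_add, map_add, map_mul, hττ,
      (hmem _).1 ξ.2]
    ring
  have hξ1 : Algebra.trace F K3 ⟨ξ0, hξ0mem⟩ = 1 := by
    have h1 := hT (ξ0 * (e ⊗ₜ[F] (1 : K2))) (hmemT _)
    rw [← hξ0, hℓ, hα, map_one, mul_one] at h1
    have h2 : Trd (α1 e) = 1 := hinjB (by rw [hTrd, hc1, ← map_add, he, map_one, map_one])
    rw [← h2, h1]
    congr 1
    apply Subtype.ext
    simp only [map_mul, (hmem _).1 hξ0mem, hτt, map_one]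
    rw [← mul_add, ← TensorProduct.add_tmul, he, ← Algebra.TensorProduct.one_def, mul_one]
  have hex : ∀ (x : K1 ⊗[F] K2) (h : ξ0 * x * τ3 x ∈ K3),
      Nrd (α x) = Algebra.trace F K3 ⟨ξ0 * x * τ3 x, h⟩ := by
    intro x h
    induction x using TensorProduct.induction_on with
    | zero =>
      have : Nrd (α 0) = 0 := hinjB (by rw [hNrd, map_zero, zero_mul, map_zero])
      rw [this, eq_comm]
      convert map_zero (Algebra.trace F K3)
      simp
    | tmul x y =>
      obtain ⟨n, hn⟩ := (hfix1 (x * σ1 x)).1 (by rw [map_mul, hσ1 x, mul_comm])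
      obtain ⟨m, hm⟩ := (hfix2 (y * σ2 y)).1 (by rw [map_mul, hσ2 y, mul_comm])
      have h1 : Nrd (α (x ⊗ₜ y)) = n * m := hinjB (by
        rw [hNrd, hα, hι_mul, hc1, hc2, mul_assoc, ← mul_assoc (α2 y), ← map_mul α2, ← hm,
          AlgHom.commutes, Algebra.commutes, ← mul_assoc, ← map_mul α1, ← hn,
          AlgHom.commutes, map_mul])
      have h2 : (⟨ξ0 * x ⊗ₜ y * τ3 (x ⊗ₜ y), h⟩ : K3) = (n * m) • ⟨ξ0, hξ0mem⟩ := by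
        apply Subtype.ext
        change ξ0 * x ⊗ₜ y * τ3 (x ⊗ₜ y) = (n * m) • ξ0
        rw [hτt, mul_assoc, Algebra.TensorProduct.tmul_mul_tmul, ← hn, ← hm,
          Algebra.algebraMap_eq_smul_one, Algebra.algebraMap_eq_smul_one,
          TensorProduct.smul_tmul_smul, ← Algebra.TensorProduct.one_def, mul_smul_comm, mul_one]
      rw [h1, h2, map_smul, hξ1, smul_eq_mul, mul_one]
    | add x y hx hy =>
      rw [map_add, hNadd, hx (hmemN ⟨ξ0, hξ0mem⟩ x), hy (hmemN ⟨ξ0, hξ0mem⟩ y), hform, hξ0,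
        hT _ (hmemT _), ← map_add, ← map_add]
      congr 1
      apply Subtype.ext
      simp only [AddMemClass.coe_add, map_add, map_mul, hττ, (hmem _).1 hξ0mem]
      ring
  have huniq : ∀ ξ : K3, (∀ (x : K1 ⊗[F] K2) (h : (ξ : K1 ⊗[F] K2) * x * τ3 x ∈ K3),
          Nrd (α x) = Algebra.trace F K3 ⟨(ξ : K1 ⊗[F] K2) * x * τ3 x, h⟩) →
      ξ = ⟨ξ0, hξ0mem⟩ := by
    intro ξ hξ
    apply Subtype.ext
    rw [← sub_eq_zero]
    refine hnd _ fun w => ?_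
    have h1 := hpol ξ hξ w 1
    rw [hform, hξ0, map_one, mul_one, mul_one] at h1
    rw [sub_mul, map_sub, h1, sub_self]
  refine ⟨⟨⟨ξ0, hξ0mem⟩, hex, huniq⟩, fun ξ hξ => ⟨?_, hpol ξ hξ⟩⟩
  have h := hξ1
  rw [← huniq ξ hξ] at h
  exact h
end

section
/- Let F be a field, K1 and K2 nonisomorphic quadratic field extensions of F contained in a common biquadratic extension K = K1 ⊗_F K2, with K3 the third intermediate quadratic extension (the fixed field of τ3 = σ1 ⊗ σ2). Then the invariant map establishes a bijection between the set of isomorphism classes of regular quaternion embeddings (B, α1, α2) of (K1, K2) and the set { ξ ∈ K3^× : Tr_{K3/F}(ξ) = 1 }. -/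
open scoped TensorProduct

/-- A quaternion embedding of the pair `(K1, K2)`: a quaternion `F`-algebra `B` (central
simple of dimension 4) together with `F`-algebra embeddings `α1 : K1 → B`, `α2 : K2 → B`. -/
structure QuaternionEmbedding (F K1 K2 : Type u) [Field F] [Field K1] [Field K2]
    [Algebra F K1] [Algebra F K2] where
  B : Type u
  [ringB : Ring B]
  [algB : Algebra F B]
  central : Algebra.IsCentral F B
  simple : IsSimpleRing B
  dim4 : Module.finrank F B = 4
  α1 : K1 →ₐ[F] B
  α2 : K2 →ₐ[F] B

attribute [instance] QuaternionEmbedding.ringB QuaternionEmbedding.algB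

variable {F K1 K2 : Type u} [Field F] [Field K1] [Field K2] [Algebra F K1] [Algebra F K2]

/-- A quaternion embedding is regular if `α1(K1) ∪ α2(K2)` generates `B` as an `F`-algebra. -/
def QuaternionEmbedding.Regular (E : QuaternionEmbedding F K1 K2) : Prop :=
  Algebra.adjoin F (Set.range E.α1 ∪ Set.range E.α2) = ⊤

/-- Two quaternion embeddings are isomorphic if there is an `F`-algebra isomorphism of the
underlying quaternion algebras intertwining both embeddings. -/
def QuaternionEmbedding.Isomorphic (E E' : QuaternionEmbedding F K1 K2) : Prop :=
  ∃ e : E.B ≃ₐ[F] E'.B, (∀ x, e (E.α1 x) = E'.α1 x) ∧ (∀ y, e (E.α2 y) = E'.α2 y)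

/-- The `F`-linear map `α : K1 ⊗[F] K2 → B`, `x ⊗ y ↦ α1 x * α2 y`. -/
noncomputable def QuaternionEmbedding.mulMap (E : QuaternionEmbedding F K1 K2) :
    K1 ⊗[F] K2 →ₗ[F] E.B :=
  TensorProduct.lift ((LinearMap.mul F E.B).compl₁₂ E.α1.toLinearMap E.α2.toLinearMap)

variable (σ1 : K1 ≃ₐ[F] K1) (σ2 : K2 ≃ₐ[F] K2)

/-- The automorphism `τ3 = σ1 ⊗ σ2` of `K = K1 ⊗[F] K2`. -/
noncomputable def tau3 : (K1 ⊗[F] K2) ≃ₐ[F] (K1 ⊗[F] K2) :=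
  Algebra.TensorProduct.congr σ1 σ2

/-- The subalgebra `K3 ⊆ K = K1 ⊗[F] K2` of fixed points of `τ3`. -/
noncomputable def fixedK3 : Subalgebra F (K1 ⊗[F] K2) :=
  AlgHom.equalizer ((tau3 σ1 σ2 : (K1 ⊗[F] K2) ≃ₐ[F] (K1 ⊗[F] K2)) :
    (K1 ⊗[F] K2) →ₐ[F] (K1 ⊗[F] K2)) (AlgHom.id F (K1 ⊗[F] K2))

/-- `ξ ∈ K3` is the invariant of the quaternion embedding `E = (B, α1, α2)`:
for some (equivalently, the unique) main involution `ι` with reduced norm `Nrd` on `B`,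
`Nrd (α x) = Tr_{K3/F} (ξ · x · x^{τ3})` for all `x ∈ K`. -/
noncomputable def QuaternionEmbedding.IsInvariant (E : QuaternionEmbedding F K1 K2)
    (ξ : fixedK3 σ1 σ2) : Prop :=
  ∃ (ι : E.B → E.B) (Nrd : E.B → F),
    (∀ a b : E.B, ι (a + b) = ι a + ι b) ∧
    (∀ a b : E.B, ι (a * b) = ι b * ι a) ∧
    Function.Involutive ι ∧
    (∀ c : F, ι (algebraMap F E.B c) = algebraMap F E.B c) ∧
    (∀ b : E.B, algebraMap F E.B (Nrd b) = b * ι b) ∧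
    ∀ (x : K1 ⊗[F] K2)
      (h : (ξ : K1 ⊗[F] K2) * x * tau3 σ1 σ2 x ∈ fixedK3 σ1 σ2),
      Nrd (E.mulMap x) =
        Algebra.trace F (fixedK3 σ1 σ2) ⟨(ξ : K1 ⊗[F] K2) * x * tau3 σ1 σ2 x, h⟩


section Helpers

/-- Data of a generator of trace one of a separable quadratic extension. -/
structure QData (F K : Type u) [Field F] [Field K] [Algebra F K] (σ : K ≃ₐ[F] K) where
  a : K
  n : F
  hσ : σ a = 1 - a
  sq : a * a = a - algebraMap F K n
  disc : 1 - 4 * n ≠ 0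
  span : ∀ x : K, ∃ p q : F, x = algebraMap F K p + algebraMap F K q * a
  indep : ∀ p q : F, algebraMap F K p + algebraMap F K q * a = 0 → p = 0 ∧ q = 0

theorem quad_span (F K : Type u) [Field F] [Field K] [Algebra F K]
    (hK : Module.finrank F K = 2) (x : K) (hx : ∀ c : F, algebraMap F K c ≠ x) :
    (∀ p q : F, algebraMap F K p + algebraMap F K q * x = 0 → p = 0 ∧ q = 0) ∧
    (∀ y : K, ∃ p q : F, y = algebraMap F K p + algebraMap F K q * x) := by
  have hind : ∀ p q : F, algebraMap F K p + algebraMap F K q * x = 0 → p = 0 ∧ q = 0 := by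
    intro p q h
    have hq : q = 0 := by
      by_contra hq
      apply hx (-p / q)
      have : algebraMap F K q ≠ 0 := by simpa using hq
      rw [map_div₀, map_neg]
      field_simp
      linear_combination -h
    subst hq
    simpa using h
  refine ⟨hind, ?_⟩
  have hli : LinearIndependent F ![(1 : K), x] := by
    rw [LinearIndependent.pair_iff]
    intro s t h
    apply hind
    simpa [Algebra.smul_def] using h
  intro y
  have : FiniteDimensional F K := Module.finite_of_finrank_pos (by omega)
  have hspan := hli.span_eq_top_of_card_eq_finrank' (by simp [hK])
  have hy : y ∈ Submodule.span F (Set.range ![(1 : K), x]) := by rw [hspan]; trivial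
  simp only [Matrix.range_cons, Matrix.range_empty, Set.union_empty, Set.singleton_union] at hy
  rw [Submodule.mem_span_pair] at hy
  obtain ⟨p, q, h⟩ := hy
  exact ⟨p, q, by rw [← h]; simp [Algebra.smul_def]⟩

theorem quad_exists (F K : Type u) [Field F] [Field K] [Algebra F K]
    (hK : Module.finrank F K = 2) (σ : K ≃ₐ[F] K) (hσ : Function.Involutive σ)
    (hne : σ ≠ AlgEquiv.refl) : Nonempty (QData F K σ) := by
  obtain ⟨x, hx⟩ : ∃ x, σ x ≠ x := by
    by_contra! h
    exact hne (AlgEquiv.ext h)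
  have notF : ∀ y, σ y ≠ y → ∀ c : F, algebraMap F K c ≠ y := by
    intro y hy c hc
    apply hy
    rw [← hc]; simp
  have hfix : ∀ z, σ z = z → ∃ c : F, algebraMap F K c = z := by
    intro z hz
    obtain ⟨p, q, h⟩ := (quad_span F K hK x (notF x hx)).2 z
    by_cases hq : q = 0
    · exact ⟨p, by rw [h, hq]; simp⟩
    · exfalso
      apply hx
      have h2 := congrArg σ h
      rw [hz, h] at h2
      simp only [map_add, map_mul, AlgEquiv.commutes] at h2
      have hq' : algebraMap F K q ≠ 0 := by simpa using hq
      exact (mul_left_cancel₀ hq' (add_left_cancel h2)).symm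
  obtain ⟨a, ha⟩ : ∃ a, σ a = 1 - a ∧ σ a ≠ a := by
    by_cases h2 : (2 : F) = 0
    · have h2K : (2 : K) = 0 := by
        have := congrArg (algebraMap F K) h2
        rwa [map_ofNat, map_zero] at this
      obtain ⟨t, ht⟩ := hfix (x + σ x) (by rw [map_add, hσ x, add_comm])
      have ht0 : algebraMap F K t ≠ 0 := by
        intro h
        apply hx
        rw [h] at ht
        linear_combination -ht - x * h2K
      have hsx : σ x = algebraMap F K t - x := by rw [ht]; ring
      have : σ (algebraMap F K t⁻¹ * x) = 1 - algebraMap F K t⁻¹ * x := by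
        rw [map_mul, AlgEquiv.commutes, hsx, map_inv₀]
        field_simp
      refine ⟨algebraMap F K t⁻¹ * x, this, ?_⟩
      intro h
      apply hx
      rw [map_mul, AlgEquiv.commutes] at h
      exact mul_left_cancel₀ (by simpa using ht0) h
    · have h2K : (2 : K) ≠ 0 := by
        intro h
        apply h2
        apply (algebraMap F K).injective
        rwa [map_ofNat, map_zero]
      refine ⟨(1 + (x - σ x)) / 2, ?_, ?_⟩
      · simp only [map_div₀, map_add, map_one, map_sub, hσ x, map_ofNat]
        field_simp
        ring
      · simp only [map_div₀, map_add, map_one, map_sub, hσ x, map_ofNat]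
        intro h
        apply hx
        field_simp at h
        have : 2 * σ x = 2 * x := by linear_combination h
        exact mul_left_cancel₀ h2K this
  obtain ⟨ha1, ha2⟩ := ha
  obtain ⟨n, hn⟩ := hfix (a * (1 - a)) (by
    rw [map_mul, map_sub, map_one, ha1]; ring)
  obtain ⟨h1, h2⟩ := quad_span F K hK a (notF a ha2)
  refine ⟨⟨a, n, ha1, by rw [hn]; ring, ?_, h2, h1⟩⟩
  intro h
  apply ha2
  have h3 : (1 - 2 * a) ^ 2 = 0 := by
    have := congrArg (algebraMap F K) h
    simp only [map_sub, map_one, map_mul, map_ofNat, map_zero, hn] at this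
    linear_combination this
  have h4 : 1 - 2 * a = 0 := by simpa using h3
  rw [ha1]
  linear_combination h4

/-- Extension of a generator to an algebra homomorphism. -/
theorem QData.lift {F K : Type u} [Field F] [Field K] [Algebra F K] {σ : K ≃ₐ[F] K}
    (d : QData F K σ) {B : Type u} [Ring B] [Algebra F B] (y : B)
    (hy : y * y = y - algebraMap F B d.n) : ∃ f : K →ₐ[F] B, f d.a = y := by
  have hli : LinearIndependent F ![(1 : K), d.a] := by
    rw [LinearIndependent.pair_iff]
    intro s t h
    apply d.indep
    simpa [Algebra.smul_def] using h
  have hsp : ⊤ ≤ Submodule.span F (Set.range ![(1 : K), d.a]) := by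
    intro x _
    simp only [Matrix.range_cons, Matrix.range_empty, Set.union_empty, Set.singleton_union]
    rw [Submodule.mem_span_pair]
    obtain ⟨p, q, h⟩ := d.span x
    exact ⟨p, q, by rw [h]; simp [Algebra.smul_def]⟩
  let bs := Module.Basis.mk hli hsp
  let f : K →ₗ[F] B := bs.constr F ![1, y]
  have f0 : f 1 = 1 := by
    have := bs.constr_basis F ![(1 : B), y] 0
    rwa [show bs 0 = 1 by simp [bs]] at this
  have f1 : f d.a = y := by
    have := bs.constr_basis F ![(1 : B), y] 1
    rwa [show bs 1 = d.a by simp [bs]] at this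
  have fpq : ∀ p q : F, f (algebraMap F K p + algebraMap F K q * d.a) = p • 1 + q • y := by
    intro p q
    rw [map_add, ← Algebra.smul_def, Algebra.algebraMap_eq_smul_one, map_smul, map_smul, f0, f1]
  refine ⟨AlgHom.ofLinearMap f f0 ?_, f1⟩
  intro u v
  obtain ⟨p, q, rfl⟩ := d.span u
  obtain ⟨r, s, rfl⟩ := d.span v
  have : (algebraMap F K p + algebraMap F K q * d.a) * (algebraMap F K r + algebraMap F K s * d.a)
      = algebraMap F K (p * r - q * s * d.n) + algebraMap F K (p * s + q * r + q * s) * d.a := by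
    simp only [map_add, map_mul, map_sub]
    linear_combination algebraMap F K q * algebraMap F K s * d.sq
  rw [this, fpq, fpq, fpq]
  simp only [add_mul, mul_add, smul_mul_assoc, mul_smul_comm, hy, one_mul, mul_one,
    Algebra.algebraMap_eq_smul_one]
  module

theorem QData.hom_ext {F K : Type u} [Field F] [Field K] [Algebra F K] {σ : K ≃ₐ[F] K}
    (d : QData F K σ) {B : Type u} [Ring B] [Algebra F B] (f g : K →ₐ[F] B)
    (h : f d.a = g d.a) (x : K) : f x = g x := by
  obtain ⟨p, q, rfl⟩ := d.span x
  simp [h]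

/-- The quadratic norm form has no nontrivial zero. -/
theorem QData.aniso {F K : Type u} [Field F] [Field K] [Algebra F K] {σ : K ≃ₐ[F] K}
    (d : QData F K σ) (p q : F) (h : p * p + p * q + d.n * q * q = 0) : p = 0 ∧ q = 0 := by
  have h1 : (algebraMap F K p + algebraMap F K q * d.a) *
      (algebraMap F K (p + q) + algebraMap F K (-q) * d.a) = 0 := by
    have h2 := congrArg (algebraMap F K) h
    simp only [map_add, map_mul, map_neg, map_zero] at h2 ⊢
    linear_combination h2 - algebraMap F K q * algebraMap F K q * d.sq
  rcases mul_eq_zero.1 h1 with h1 | h1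
  · exact d.indep _ _ h1
  · have := d.indep _ _ h1
    simp only [neg_eq_zero] at this
    refine ⟨by simpa [this.2] using this.1, this.2⟩

/-- The trace of a quadratic algebra in terms of a generator of trace one. -/
theorem trace_quad (F S : Type*) [Field F] [CommRing S] [Algebra F S] (e : S) (n : F)
    (sq : e * e = e - algebraMap F S n)
    (span : ∀ x : S, ∃ p q : F, x = algebraMap F S p + algebraMap F S q * e)
    (indep : ∀ p q : F, algebraMap F S p + algebraMap F S q * e = 0 → p = 0 ∧ q = 0) (p q : F) :
    Algebra.trace F S (algebraMap F S p + algebraMap F S q * e) = 2 * p + q := by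
  have hli : LinearIndependent F ![(1 : S), e] := by
    rw [LinearIndependent.pair_iff]
    intro s t h
    apply indep
    simpa [Algebra.smul_def] using h
  have hsp : ⊤ ≤ Submodule.span F (Set.range ![(1 : S), e]) := by
    intro x _
    simp only [Matrix.range_cons, Matrix.range_empty, Set.union_empty, Set.singleton_union]
    rw [Submodule.mem_span_pair]
    obtain ⟨p, q, h⟩ := span x
    exact ⟨p, q, by rw [h]; simp [Algebra.smul_def]⟩
  let bs := Module.Basis.mk hli hsp
  have b0 : bs 0 = 1 := by simp [bs]
  have b1 : bs 1 = e := by simp [bs]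
  have key : ∀ r s : F, algebraMap F S r + algebraMap F S s * e = r • bs 0 + s • bs 1 := by
    intro r s
    rw [b0, b1]; simp [Algebra.smul_def]
  rw [Algebra.trace_eq_matrix_trace bs, Matrix.trace_fin_two, Algebra.leftMulMatrix_eq_repr_mul,
    Algebra.leftMulMatrix_eq_repr_mul]
  have e0 : (algebraMap F S p + algebraMap F S q * e) * bs 0 = p • bs 0 + q • bs 1 := by
    rw [← key, b0, mul_one]
  have e1 : (algebraMap F S p + algebraMap F S q * e) * bs 1 =
      (- q * n) • bs 0 + (p + q) • bs 1 := by
    rw [← key, b1]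
    simp only [map_add, map_mul, map_neg]
    linear_combination algebraMap F S q * sq
  rw [e0, e1]
  simp
  ring

section Tensor

variable {F K1 K2 : Type u} [Field F] [Field K1] [Field K2] [Algebra F K1] [Algebra F K2]
  {s1 : K1 ≃ₐ[F] K1} {s2 : K2 ≃ₐ[F] K2} (d1 : QData F K1 s1) (d2 : QData F K2 s2)

/-- The first generator inside the tensor product. -/
noncomputable def tA (d1 : QData F K1 s1) (_ : QData F K2 s2) : K1 ⊗[F] K2 := d1.a ⊗ₜ 1

/-- The second generator inside the tensor product. -/
noncomputable def tB (_ : QData F K1 s1) (d2 : QData F K2 s2) : K1 ⊗[F] K2 := 1 ⊗ₜ d2.a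

local notation "ι" => algebraMap F (K1 ⊗[F] K2)

theorem tA_sq : tA d1 d2 * tA d1 d2 = tA d1 d2 - ι d1.n := by
  rw [tA, Algebra.TensorProduct.tmul_mul_tmul, d1.sq, TensorProduct.sub_tmul,
    Algebra.TensorProduct.algebraMap_apply, one_mul]

theorem tB_sq : tB d1 d2 * tB d1 d2 = tB d1 d2 - ι d2.n := by
  rw [tB, Algebra.TensorProduct.tmul_mul_tmul, d2.sq, TensorProduct.tmul_sub,
    Algebra.TensorProduct.algebraMap_apply', one_mul]

theorem tau_tA : tau3 s1 s2 (tA d1 d2) = 1 - tA d1 d2 := by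
  simp [tau3, tA, d1.hσ, TensorProduct.sub_tmul, Algebra.TensorProduct.one_def]

theorem tau_tB : tau3 s1 s2 (tB d1 d2) = 1 - tB d1 d2 := by
  simp [tau3, tB, d2.hσ, TensorProduct.tmul_sub, Algebra.TensorProduct.one_def]

theorem tspan (x : K1 ⊗[F] K2) : ∃ x0 x1 x2 x3 : F,
    x = ι x0 + ι x1 * tA d1 d2 + ι x2 * tB d1 d2 + ι x3 * (tA d1 d2 * tB d1 d2) := by
  induction x using TensorProduct.induction_on with
  | zero => exact ⟨0, 0, 0, 0, by simp⟩
  | tmul x y =>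
    obtain ⟨p, q, rfl⟩ := d1.span x
    obtain ⟨r, s, rfl⟩ := d2.span y
    refine ⟨p * r, q * r, p * s, q * s, ?_⟩
    have h1 : ∀ x y, x ⊗ₜ[F] y = (x ⊗ₜ[F] (1 : K2)) * ((1 : K1) ⊗ₜ[F] y) := by
      intro x y; simp
    have h2 : (algebraMap F K1 p + algebraMap F K1 q * d1.a) ⊗ₜ[F] (1 : K2) =
        ι p + ι q * tA d1 d2 := by
      simp [Algebra.TensorProduct.algebraMap_apply, tA, TensorProduct.add_tmul]
    have h3 : (1 : K1) ⊗ₜ[F] (algebraMap F K2 r + algebraMap F K2 s * d2.a) =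
        ι r + ι s * tB d1 d2 := by
      rw [Algebra.TensorProduct.algebraMap_apply', Algebra.TensorProduct.algebraMap_apply', tB,
        TensorProduct.tmul_add, Algebra.TensorProduct.tmul_mul_tmul, one_mul]
    rw [h1, h2, h3]
    simp only [map_mul]
    ring
  | add x y hx hy =>
    obtain ⟨a, b, c, d, rfl⟩ := hx
    obtain ⟨a', b', c', d', rfl⟩ := hy
    exact ⟨a + a', b + b', c + c', d + d', by simp only [map_add]; ring⟩

/-- A spanning family of four vectors in dimension four is independent. -/
theorem indep4 {V : Type*} [AddCommGroup V] [Module F V] (hV : Module.finrank F V = 4)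
    (v0 v1 v2 v3 : V)
    (h : ∀ x : V, ∃ a b c d : F, x = a • v0 + b • v1 + c • v2 + d • v3) (a b c d : F)
    (h0 : a • v0 + b • v1 + c • v2 + d • v3 = 0) : a = 0 ∧ b = 0 ∧ c = 0 ∧ d = 0 := by
  have hli : LinearIndependent F ![v0, v1, v2, v3] := by
    apply linearIndependent_of_top_le_span_of_card_eq_finrank
    · intro x _
      obtain ⟨a, b, c, d, rfl⟩ := h x
      have hm : ∀ i, (![v0, v1, v2, v3] : Fin 4 → V) i ∈
        Submodule.span F (Set.range ![v0, v1, v2, v3]) :=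
        fun i => Submodule.subset_span ⟨i, rfl⟩
      exact add_mem (add_mem (add_mem (Submodule.smul_mem _ a (hm 0))
        (Submodule.smul_mem _ b (hm 1))) (Submodule.smul_mem _ c (hm 2)))
        (Submodule.smul_mem _ d (hm 3))
    · simp [hV]
  have := Fintype.linearIndependent_iff.1 hli ![a, b, c, d] (by
    simpa [Fin.sum_univ_four] using h0)
  exact ⟨this 0, this 1, this 2, this 3⟩

theorem tindep (hK1 : Module.finrank F K1 = 2) (hK2 : Module.finrank F K2 = 2)
    (x0 x1 x2 x3 : F)
    (h : ι x0 + ι x1 * tA d1 d2 + ι x2 * tB d1 d2 + ι x3 * (tA d1 d2 * tB d1 d2) = 0) :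
    x0 = 0 ∧ x1 = 0 ∧ x2 = 0 ∧ x3 = 0 := by
  apply indep4 (F := F) (V := K1 ⊗[F] K2) (by rw [Module.finrank_tensorProduct, hK1, hK2])
    1 (tA d1 d2) (tB d1 d2) (tA d1 d2 * tB d1 d2)
  · intro x
    obtain ⟨a, b, c, d, rfl⟩ := tspan d1 d2 x
    exact ⟨a, b, c, d, by simp [Algebra.smul_def]⟩
  · simpa [Algebra.smul_def] using h

theorem mem_fixed (x : K1 ⊗[F] K2) : x ∈ fixedK3 s1 s2 ↔ tau3 s1 s2 x = x := Iff.rfl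

/-- The generator of trace one of the third quadratic subalgebra. -/
noncomputable def eK : fixedK3 s1 s2 :=
  ⟨tA d1 d2 + tB d1 d2 - 2 * (tA d1 d2 * tB d1 d2), by
    rw [mem_fixed]
    simp only [map_add, map_sub, map_mul, tau_tA, tau_tB, map_ofNat]
    ring⟩

/-- Its norm. -/
def n3 : F := d1.n + d2.n - 4 * d1.n * d2.n

local notation "κ" => algebraMap F (fixedK3 s1 s2)

theorem coe_lin (p q : F) : ((κ p + κ q * eK d1 d2 : fixedK3 s1 s2) : K1 ⊗[F] K2) =
    ι p + ι q * (tA d1 d2 + tB d1 d2 - 2 * (tA d1 d2 * tB d1 d2)) := rfl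

theorem eK_sq : eK d1 d2 * eK d1 d2 = eK d1 d2 - κ (n3 d1 d2) := by
  apply Subtype.ext
  change (tA d1 d2 + tB d1 d2 - 2 * (tA d1 d2 * tB d1 d2)) *
    (tA d1 d2 + tB d1 d2 - 2 * (tA d1 d2 * tB d1 d2)) =
    (tA d1 d2 + tB d1 d2 - 2 * (tA d1 d2 * tB d1 d2)) - ι (n3 d1 d2)
  simp only [n3, map_add, map_sub, map_mul, map_ofNat]
  have hA := tA_sq d1 d2
  have hB := tB_sq d1 d2
  generalize tA d1 d2 = a at *
  generalize tB d1 d2 = b at *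
  linear_combination (1 - 4 * b + 4 * b * b) * hA + (1 - 4 * ι d1.n) * hB

theorem eK_span (hK1 : Module.finrank F K1 = 2) (hK2 : Module.finrank F K2 = 2)
    (x : fixedK3 s1 s2) : ∃ p q : F, x = κ p + κ q * eK d1 d2 := by
  obtain ⟨x, hx⟩ := x
  have hx' := (mem_fixed x).1 hx
  obtain ⟨a, b, c, d, rfl⟩ := tspan d1 d2 x
  simp only [map_add, map_mul, AlgEquiv.commutes, tau_tA, tau_tB] at hx'
  have := tindep d1 d2 hK1 hK2 (b + c + d) (-2 * b - d) (-2 * c - d) 0 (by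
    simp only [map_add, map_sub, map_mul, map_neg, map_ofNat, map_zero]
    linear_combination hx')
  obtain ⟨h1, h2, h3, -⟩ := this
  have hbc : c = b := by linear_combination h1 + h2
  have hd : d = -2 * b := by linear_combination -h2
  subst hbc hd
  refine ⟨a, c, ?_⟩
  apply Subtype.ext
  rw [coe_lin]
  simp only [map_mul, map_neg, map_ofNat]
  ring

theorem eK_indep (hK1 : Module.finrank F K1 = 2) (hK2 : Module.finrank F K2 = 2)
    (p q : F) (h : κ p + κ q * eK d1 d2 = 0) : p = 0 ∧ q = 0 := by
  have h1 := congrArg Subtype.val h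
  rw [coe_lin] at h1
  have := tindep d1 d2 hK1 hK2 p q q (-2 * q) (by
    simp only [map_mul, map_neg, map_ofNat]
    have h2 : ((0 : fixedK3 s1 s2) : K1 ⊗[F] K2) = 0 := rfl
    rw [h2] at h1
    linear_combination h1)
  exact ⟨this.1, this.2.1⟩

theorem trace_eK (hK1 : Module.finrank F K1 = 2) (hK2 : Module.finrank F K2 = 2) (p q : F) :
    Algebra.trace F (fixedK3 s1 s2) (κ p + κ q * eK d1 d2) = 2 * p + q :=
  trace_quad F _ _ _ (eK_sq d1 d2) (eK_span d1 d2 hK1 hK2) (eK_indep d1 d2 hK1 hK2) p q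

/-- The norm of a general element to the third quadratic subalgebra. -/
theorem norm_formula (u v x0 x1 x2 x3 : F) (x : K1 ⊗[F] K2)
    (hx : x = ι x0 + ι x1 * tA d1 d2 + ι x2 * tB d1 d2 + ι x3 * (tA d1 d2 * tB d1 d2))
    (P Q : F)
    (hP : P = x0 * x0 + d1.n * x1 * x1 + d2.n * x2 * x2 + d1.n * d2.n * x3 * x3 + x0 * x1 +
      x0 * x2 + d1.n * x1 * x3 + d2.n * x2 * x3 + x0 * x3)
    (hQ : Q = x1 * x2 - x0 * x3) :
    ((κ u + κ v * eK d1 d2 : fixedK3 s1 s2) : K1 ⊗[F] K2) * x * tau3 s1 s2 x =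
    ((κ (u * P - v * Q * n3 d1 d2) + κ (u * Q + v * P + v * Q) * eK d1 d2 : fixedK3 s1 s2) :
      K1 ⊗[F] K2) := by
  have key : x * tau3 s1 s2 x = ((κ P + κ Q * eK d1 d2 : fixedK3 s1 s2) : K1 ⊗[F] K2) := by
    rw [coe_lin, hx]
    simp only [map_add, map_mul, AlgEquiv.commutes, tau_tA, tau_tB]
    rw [hP, hQ]
    simp only [map_add, map_mul, map_sub]
    have hA := tA_sq d1 d2
    have hB := tB_sq d1 d2
    generalize tA d1 d2 = a at *
    generalize tB d1 d2 = b at *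
    have hA' : ι d1.n = a - a * a := by linear_combination hA
    have hB' : ι d2.n = b - b * b := by linear_combination hB
    rw [hA', hB']
    ring
  rw [mul_assoc, key, ← MulMemClass.coe_mul]
  congr 1
  simp only [map_add, map_mul, map_sub]
  linear_combination κ v * κ Q * eK_sq d1 d2

theorem trace_norm (hK1 : Module.finrank F K1 = 2) (hK2 : Module.finrank F K2 = 2)
    (u v x0 x1 x2 x3 : F) (x : K1 ⊗[F] K2)
    (hx : x = ι x0 + ι x1 * tA d1 d2 + ι x2 * tB d1 d2 + ι x3 * (tA d1 d2 * tB d1 d2))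
    (P Q : F)
    (hP : P = x0 * x0 + d1.n * x1 * x1 + d2.n * x2 * x2 + d1.n * d2.n * x3 * x3 + x0 * x1 +
      x0 * x2 + d1.n * x1 * x3 + d2.n * x2 * x3 + x0 * x3)
    (hQ : Q = x1 * x2 - x0 * x3) (ξ : fixedK3 s1 s2) (hξ : ξ = κ u + κ v * eK d1 d2)
    (h : (ξ : K1 ⊗[F] K2) * x * tau3 s1 s2 x ∈ fixedK3 s1 s2) :
    Algebra.trace F (fixedK3 s1 s2) ⟨(ξ : K1 ⊗[F] K2) * x * tau3 s1 s2 x, h⟩ =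
      2 * (u * P - v * Q * n3 d1 d2) + (u * Q + v * P + v * Q) := by
  rw [← trace_eK d1 d2 hK1 hK2]
  congr 1
  apply Subtype.ext
  have := norm_formula d1 d2 u v x0 x1 x2 x3 x hx P Q hP hQ
  rw [← hξ] at this
  exact this

theorem mem_norm (ht : Function.Involutive (tau3 s1 s2)) (ξ : fixedK3 s1 s2) (x : K1 ⊗[F] K2) :
    (ξ : K1 ⊗[F] K2) * x * tau3 s1 s2 x ∈ fixedK3 s1 s2 := by
  rw [mem_fixed, map_mul, map_mul, ht x, (mem_fixed _).1 ξ.2]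
  ring

theorem tau_invol (d1 : QData F K1 s1) (d2 : QData F K2 s2) :
    Function.Involutive (tau3 s1 s2) := by
  intro x
  obtain ⟨a, b, c, d, rfl⟩ := tspan d1 d2 x
  simp only [map_add, map_mul, map_sub, map_one, AlgEquiv.commutes, tau_tA, tau_tB]
  ring

end Tensor

section Emb

variable {F K1 K2 : Type u} [Field F] [Field K1] [Field K2] [Algebra F K1] [Algebra F K2]
  {s1 : K1 ≃ₐ[F] K1} {s2 : K2 ≃ₐ[F] K2} (d1 : QData F K1 s1) (d2 : QData F K2 s2)

/-- Linear combinations of the four standard elements. -/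
def lin {B : Type*} [Ring B] [Algebra F B] (A b : B) (x0 x1 x2 x3 : F) : B :=
  x0 • (1 : B) + x1 • A + x2 • b + x3 • (A * b)

theorem lin_leftA {B : Type*} [Ring B] [Algebra F B] (A b : B) (m : F)
    (hA : A * A = A - algebraMap F B m) (x0 x1 x2 x3 : F) :
    A * lin A b x0 x1 x2 x3 = lin A b (-m * x1) (x0 + x1) (-m * x3) (x2 + x3) := by
  simp only [lin, mul_add, mul_smul_comm, mul_one, ← mul_assoc, hA, sub_mul,
    Algebra.algebraMap_eq_smul_one, smul_mul_assoc, one_mul]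
  module

theorem lin_leftB {B : Type*} [Ring B] [Algebra F B] (A b : B) (m T : F)
    (hb : b * b = b - algebraMap F B m)
    (hbA : b * A = A + b - A * b - algebraMap F B T) (x0 x1 x2 x3 : F) :
    b * lin A b x0 x1 x2 x3 = lin A b (-T * x1 - m * x2 - m * x3) (x1 + m * x3)
      (x0 + x1 + x2 + (1 - T) * x3) (-x1) := by
  simp only [lin, mul_add, mul_smul_comm, mul_one, ← mul_assoc, hbA]
  simp only [sub_mul, add_mul, mul_assoc, hb, mul_sub,
    Algebra.algebraMap_eq_smul_one, smul_mul_assoc, one_mul, mul_smul_comm, mul_one]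
  module

theorem mulMap_lin (E : QuaternionEmbedding F K1 K2) (x0 x1 x2 x3 : F) :
    E.mulMap (algebraMap F (K1 ⊗[F] K2) x0 + algebraMap F (K1 ⊗[F] K2) x1 * tA d1 d2 +
      algebraMap F (K1 ⊗[F] K2) x2 * tB d1 d2 +
      algebraMap F (K1 ⊗[F] K2) x3 * (tA d1 d2 * tB d1 d2)) =
    lin (E.α1 d1.a) (E.α2 d2.a) x0 x1 x2 x3 := by
  simp only [← Algebra.smul_def]
  simp only [Algebra.algebraMap_eq_smul_one, map_add, map_smul, lin]
  simp [tA, tB, QuaternionEmbedding.mulMap, Algebra.TensorProduct.one_def]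

theorem α1_sq (E : QuaternionEmbedding F K1 K2) :
    E.α1 d1.a * E.α1 d1.a = E.α1 d1.a - algebraMap F E.B d1.n := by
  rw [← map_mul, d1.sq, map_sub, AlgHom.commutes]

theorem α2_sq (E : QuaternionEmbedding F K1 K2) :
    E.α2 d2.a * E.α2 d2.a = E.α2 d2.a - algebraMap F E.B d2.n := by
  rw [← map_mul, d2.sq, map_sub, AlgHom.commutes]

theorem invol_gen {K : Type u} [Field K] [Algebra F K] {s : K ≃ₐ[F] K} (d : QData F K s)
    {B : Type u} [Ring B] [Nontrivial B] [Algebra F B] (f : K →ₐ[F] B)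
    (i : B → B) (N : B → F)
    (hadd : ∀ a b : B, i (a + b) = i a + i b)
    (hF : ∀ c : F, i (algebraMap F B c) = algebraMap F B c)
    (hN : ∀ b : B, algebraMap F B (N b) = b * i b) : i (f d.a) = 1 - f d.a := by
  have h1 : i 1 = 1 := by simpa using hF 1
  have ha := hN (f d.a)
  have hb := hN (f d.a + 1)
  rw [hadd, h1] at hb
  have hs : i (f d.a) =
      algebraMap F B (N (f d.a + 1) - N (f d.a) - 1) - f d.a := by
    rw [map_sub, map_sub, hb, ha, map_one]
    noncomm_ring
  set c := N (f d.a + 1) - N (f d.a) - 1 with hc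
  rw [hs] at ha ⊢
  have h2 : f (algebraMap F K (N (f d.a) - d.n) + algebraMap F K (1 - c) * d.a) = 0 := by
    have hsq : f d.a * f d.a = f d.a - algebraMap F B d.n := by
      rw [← map_mul, d.sq, map_sub, AlgHom.commutes]
    simp only [map_add, map_mul, AlgHom.commutes, map_sub, ha, map_one]
    rw [mul_sub, hsq, ← Algebra.commutes c (f d.a)]
    noncomm_ring
  have h3 := d.indep _ _ (f.toRingHom.injective (h2.trans (map_zero f).symm))
  rw [show c = 1 by linear_combination -h3.2, map_one]

theorem nontriv (E : QuaternionEmbedding F K1 K2) : Nontrivial E.B := by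
  have := E.simple
  infer_instance

/-- The quantity determining the multiplication table. -/
def TT (u v : F) : F := u + v - 2 * v * n3 d1 d2

theorem inv_relation (hK1 : Module.finrank F K1 = 2) (hK2 : Module.finrank F K2 = 2)
    (E : QuaternionEmbedding F K1 K2) (u v : F)
    (ξ : fixedK3 s1 s2) (hξ : ξ = algebraMap F (fixedK3 s1 s2) u +
      algebraMap F (fixedK3 s1 s2) v * eK d1 d2) (h : E.IsInvariant s1 s2 ξ) :
    2 * u + v = 1 ∧ E.α2 d2.a * E.α1 d1.a = E.α1 d1.a + E.α2 d2.a - E.α1 d1.a * E.α2 d2.a -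
      algebraMap F E.B (TT d1 d2 u v) := by
  have := nontriv E
  obtain ⟨i, N, hadd, -, -, hF, hN, htr⟩ := h
  have hinj : Function.Injective (algebraMap F E.B) := (algebraMap F E.B).injective
  have hA := invol_gen d1 E.α1 i N hadd hF hN
  have hB := invol_gen d2 E.α2 i N hadd hF hN
  have gen : ∀ x0 x1 x2 x3 P Q : F, P = x0 * x0 + d1.n * x1 * x1 + d2.n * x2 * x2 +
      d1.n * d2.n * x3 * x3 + x0 * x1 +
      x0 * x2 + d1.n * x1 * x3 + d2.n * x2 * x3 + x0 * x3 → Q = x1 * x2 - x0 * x3 →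
      N (lin (E.α1 d1.a) (E.α2 d2.a) x0 x1 x2 x3) =
        2 * (u * P - v * Q * n3 d1 d2) + (u * Q + v * P + v * Q) := by
    intro x0 x1 x2 x3 P Q hP hQ
    obtain ⟨x, hx⟩ : ∃ x, x = algebraMap F (K1 ⊗[F] K2) x0 +
      algebraMap F (K1 ⊗[F] K2) x1 * tA d1 d2 + algebraMap F (K1 ⊗[F] K2) x2 * tB d1 d2 +
      algebraMap F (K1 ⊗[F] K2) x3 * (tA d1 d2 * tB d1 d2) := ⟨_, rfl⟩
    have hm := mem_norm (tau_invol d1 d2) ξ x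
    have h2 := htr x hm
    rw [trace_norm d1 d2 hK1 hK2 u v x0 x1 x2 x3 x hx P Q hP hQ ξ hξ hm, hx, mulMap_lin] at h2
    exact h2
  have h1 := gen 1 0 0 0 1 0 (by ring) (by ring)
  have h2 := gen 0 1 1 0 (d1.n + d2.n) 1 (by ring) (by ring)
  have e1 : lin (E.α1 d1.a) (E.α2 d2.a) (1 : F) 0 0 0 = 1 := by simp [lin]
  have e2 : lin (E.α1 d1.a) (E.α2 d2.a) (0 : F) 1 1 0 = E.α1 d1.a + E.α2 d2.a := by simp [lin]
  rw [e1] at h1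
  rw [e2] at h2
  have huv : 2 * u + v = 1 := by
    have h3 := hN 1
    have h4 : i 1 = 1 := by simpa using hF 1
    rw [h4, mul_one, h1] at h3
    apply hinj
    rw [map_one, ← h3]
    congr 1
    ring
  refine ⟨huv, ?_⟩
  have h3 := hN (E.α1 d1.a + E.α2 d2.a)
  rw [h2, hadd, hA, hB] at h3
  have h4 : 2 * (u * (d1.n + d2.n) - v * 1 * n3 d1 d2) + (u * 1 + v * (d1.n + d2.n) + v * 1) =
    d1.n + d2.n + TT d1 d2 u v := by
    rw [TT]
    linear_combination (d1.n + d2.n) * huv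
  rw [h4, map_add, map_add] at h3
  have q1 := α1_sq d1 E
  have q2 := α2_sq d2 E
  generalize E.α1 d1.a = A at *
  generalize E.α2 d2.a = b at *
  have h5 : (A + b) * (1 - A + (1 - b)) = A + A + b + b - A * A - b * b - A * b - b * A := by
    noncomm_ring
  rw [h5, q1, q2] at h3
  have h6 : algebraMap F E.B (TT d1 d2 u v) = A + b - A * b - b * A := by
    have := congrArg (fun z => z - algebraMap F E.B d1.n - algebraMap F E.B d2.n) h3
    calc _ = _ := (by abel)
      _ = _ := this
      _ = _ := by abel
  rw [h6]
  abel

theorem TT_inj (u v u' v' : F) (h : 2 * u + v = 1) (h' : 2 * u' + v' = 1)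
    (hT : TT d1 d2 u v = TT d1 d2 u' v') : u = u' ∧ v = v' := by
  have hu : u = u' := by
    have h1 : (1 - 4 * d1.n) * (1 - 4 * d2.n) * (u - u') = 0 := by
      simp only [TT, n3] at hT
      have e1 : v = 1 - 2 * u := by linear_combination h
      have e2 : v' = 1 - 2 * u' := by linear_combination h'
      subst e1 e2
      linear_combination -hT
    rcases mul_eq_zero.1 h1 with h1 | h1
    · exact absurd h1 (mul_ne_zero d1.disc d2.disc)
    · exact sub_eq_zero.1 h1
  exact ⟨hu, by linear_combination h - h' - 2 * hu⟩

theorem lin_span (E : QuaternionEmbedding F K1 K2) (hE : E.Regular) (T : F)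
    (hbA : E.α2 d2.a * E.α1 d1.a = E.α1 d1.a + E.α2 d2.a - E.α1 d1.a * E.α2 d2.a -
      algebraMap F E.B T) (z : E.B) :
    ∃ x0 x1 x2 x3 : F, z = lin (E.α1 d1.a) (E.α2 d2.a) x0 x1 x2 x3 := by
  let W : Submodule F E.B := LinearMap.range E.mulMap
  have hW : ∀ z, z ∈ W ↔ ∃ x0 x1 x2 x3 : F, z = lin (E.α1 d1.a) (E.α2 d2.a) x0 x1 x2 x3 := by
    intro z
    constructor
    · rintro ⟨x, rfl⟩
      obtain ⟨x0, x1, x2, x3, rfl⟩ := tspan d1 d2 x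
      exact ⟨x0, x1, x2, x3, mulMap_lin ..⟩
    · rintro ⟨x0, x1, x2, x3, rfl⟩
      exact ⟨_, mulMap_lin d1 d2 E x0 x1 x2 x3⟩
  rw [← hW]
  have hA : ∀ w ∈ W, E.α1 d1.a * w ∈ W := by
    intro w hw
    obtain ⟨x0, x1, x2, x3, rfl⟩ := (hW w).1 hw
    exact (hW _).2 ⟨_, _, _, _, lin_leftA _ _ _ (α1_sq d1 E) ..⟩
  have hB : ∀ w ∈ W, E.α2 d2.a * w ∈ W := by
    intro w hw
    obtain ⟨x0, x1, x2, x3, rfl⟩ := (hW w).1 hw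
    exact (hW _).2 ⟨_, _, _, _, lin_leftB _ _ _ _ (α2_sq d2 E) hbA ..⟩
  have key : ∀ z ∈ Algebra.adjoin F (Set.range E.α1 ∪ Set.range E.α2), ∀ w ∈ W, z * w ∈ W := by
    intro z hz
    induction hz using Algebra.adjoin_induction with
    | mem x hx =>
      intro w hw
      rcases hx with ⟨k, rfl⟩ | ⟨k, rfl⟩
      · obtain ⟨p, q, rfl⟩ := d1.span k
        simp only [map_add, map_mul, AlgHom.commutes]
        simp only [← Algebra.smul_def, add_mul, smul_mul_assoc]
        exact add_mem (W.smul_mem _ hw) (W.smul_mem _ (hA w hw))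
      · obtain ⟨p, q, rfl⟩ := d2.span k
        simp only [map_add, map_mul, AlgHom.commutes]
        simp only [← Algebra.smul_def, add_mul, smul_mul_assoc]
        exact add_mem (W.smul_mem _ hw) (W.smul_mem _ (hB w hw))
    | algebraMap r => intro w hw; rw [← Algebra.smul_def]; exact W.smul_mem _ hw
    | add x y _ _ hx hy => intro w hw; rw [add_mul]; exact add_mem (hx w hw) (hy w hw)
    | mul x y _ _ hx hy => intro w hw; rw [mul_assoc]; exact hx _ (hy w hw)
  have h1 : (1 : E.B) ∈ W := (hW 1).2 ⟨1, 0, 0, 0, by simp [lin]⟩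
  have := key z (by rw [show Algebra.adjoin F _ = ⊤ from hE]; trivial) 1 h1
  rwa [mul_one] at this

theorem mulMap_bij (hK1 : Module.finrank F K1 = 2) (hK2 : Module.finrank F K2 = 2)
    (E : QuaternionEmbedding F K1 K2) (hE : E.Regular) (T : F)
    (hbA : E.α2 d2.a * E.α1 d1.a = E.α1 d1.a + E.α2 d2.a - E.α1 d1.a * E.α2 d2.a -
      algebraMap F E.B T) : Function.Bijective E.mulMap := by
  have hs : Function.Surjective E.mulMap := by
    intro z
    obtain ⟨x0, x1, x2, x3, rfl⟩ := lin_span d1 d2 E hE T hbA z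
    exact ⟨_, mulMap_lin d1 d2 E x0 x1 x2 x3⟩
  have : FiniteDimensional F (K1 ⊗[F] K2) := by
    apply Module.finite_of_finrank_pos
    rw [Module.finrank_tensorProduct, hK1, hK2]; norm_num
  have : FiniteDimensional F E.B := Module.finite_of_finrank_pos (by rw [E.dim4]; norm_num)
  refine ⟨?_, hs⟩
  rw [LinearMap.injective_iff_surjective_of_finrank_eq_finrank]
  · exact hs
  · rw [E.dim4, Module.finrank_tensorProduct, hK1, hK2]

theorem iso_of_eq (hK1 : Module.finrank F K1 = 2) (hK2 : Module.finrank F K2 = 2)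
    (E E' : QuaternionEmbedding F K1 K2) (hE : E.Regular) (hE' : E'.Regular) (T : F)
    (hbA : E.α2 d2.a * E.α1 d1.a = E.α1 d1.a + E.α2 d2.a - E.α1 d1.a * E.α2 d2.a -
      algebraMap F E.B T)
    (hbA' : E'.α2 d2.a * E'.α1 d1.a = E'.α1 d1.a + E'.α2 d2.a - E'.α1 d1.a * E'.α2 d2.a -
      algebraMap F E'.B T) : E.Isomorphic E' := by
  let e : E.B ≃ₗ[F] E'.B := (LinearEquiv.ofBijective _ (mulMap_bij d1 d2 hK1 hK2 E hE T hbA)).symm.trans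
    (LinearEquiv.ofBijective _ (mulMap_bij d1 d2 hK1 hK2 E' hE' T hbA'))
  have el : ∀ x0 x1 x2 x3 : F, e (lin (E.α1 d1.a) (E.α2 d2.a) x0 x1 x2 x3) =
      lin (E'.α1 d1.a) (E'.α2 d2.a) x0 x1 x2 x3 := by
    intro x0 x1 x2 x3
    rw [← mulMap_lin d1 d2 E, ← mulMap_lin d1 d2 E']
    simp only [e, LinearEquiv.trans_apply]
    have : ∀ x, (LinearEquiv.ofBijective _ (mulMap_bij d1 d2 hK1 hK2 E hE T hbA)).symm
      (E.mulMap x) = x := fun x => by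
        rw [LinearEquiv.symm_apply_eq]; rfl
    rw [this]
    rfl
  have e1 : e 1 = 1 := by simpa [lin] using el 1 0 0 0
  have eA : e (E.α1 d1.a) = E'.α1 d1.a := by simpa [lin] using el 0 1 0 0
  have eB : e (E.α2 d2.a) = E'.α2 d2.a := by simpa [lin] using el 0 0 1 0
  have mA : ∀ y, e (E.α1 d1.a * y) = E'.α1 d1.a * e y := by
    intro y
    obtain ⟨x0, x1, x2, x3, rfl⟩ := lin_span d1 d2 E hE T hbA y
    rw [lin_leftA _ _ _ (α1_sq d1 E), el, el, lin_leftA _ _ _ (α1_sq d1 E')]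
  have mB : ∀ y, e (E.α2 d2.a * y) = E'.α2 d2.a * e y := by
    intro y
    obtain ⟨x0, x1, x2, x3, rfl⟩ := lin_span d1 d2 E hE T hbA y
    rw [lin_leftB _ _ _ _ (α2_sq d2 E) hbA, el, el, lin_leftB _ _ _ _ (α2_sq d2 E') hbA']
  have i1 : ∀ k, e (E.α1 k) = E'.α1 k := by
    intro k
    obtain ⟨p, q, rfl⟩ := d1.span k
    simp only [map_add, map_mul, AlgHom.commutes]
    simp only [Algebra.algebraMap_eq_smul_one, map_smul, e1,
      smul_mul_assoc, one_mul, eA]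
  have i2 : ∀ k, e (E.α2 k) = E'.α2 k := by
    intro k
    obtain ⟨p, q, rfl⟩ := d2.span k
    simp only [map_add, map_mul, AlgHom.commutes]
    simp only [Algebra.algebraMap_eq_smul_one, map_smul, e1,
      smul_mul_assoc, one_mul, eB]
  have key : ∀ z ∈ Algebra.adjoin F (Set.range E.α1 ∪ Set.range E.α2),
      ∀ w, e (z * w) = e z * e w := by
    intro z hz
    induction hz using Algebra.adjoin_induction with
    | mem x hx =>
      intro w
      rcases hx with ⟨k, rfl⟩ | ⟨k, rfl⟩
      · rw [i1]
        obtain ⟨p, q, rfl⟩ := d1.span k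
        simp only [map_add, map_mul, AlgHom.commutes]
        simp only [map_add, ← Algebra.smul_def, add_mul, smul_mul_assoc,
          map_smul, mA]
      · rw [i2]
        obtain ⟨p, q, rfl⟩ := d2.span k
        simp only [map_add, map_mul, AlgHom.commutes]
        simp only [map_add, ← Algebra.smul_def, add_mul, smul_mul_assoc,
          map_smul, mB]
    | algebraMap r =>
      intro w
      rw [← Algebra.smul_def, Algebra.algebraMap_eq_smul_one, map_smul, map_smul, e1,
        smul_mul_assoc, one_mul]
    | add x y _ _ hx hy => intro w; rw [add_mul, map_add, hx, hy, map_add, add_mul]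
    | mul x y _ _ hx hy => intro w; rw [mul_assoc, hx, hy, hx, mul_assoc]
  exact ⟨AlgEquiv.ofLinearEquiv e e1 (fun x y => key x
    (by rw [show Algebra.adjoin F _ = ⊤ from hE]; trivial) y), i1, i2⟩

theorem norm_ne_zero (hK1 : Module.finrank F K1 = 2) (hK2 : Module.finrank F K2 = 2)
    (hne : IsEmpty (K1 ≃ₐ[F] K2)) (u v : F) (huv : 2 * u + v = 1) :
    u * u + u * v + n3 d1 d2 * v * v ≠ 0 := by
  intro h
  have hv : v ≠ 0 := by
    rintro rfl
    have : u = 0 := by simpa using h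
    rw [this] at huv
    simp at huv
  obtain ⟨r, hr⟩ : ∃ r : F, r * r - r + n3 d1 d2 = 0 := by
    refine ⟨-u / v, ?_⟩
    field_simp
    linear_combination h
  have hd := d2.disc
  have hd' : algebraMap F K2 (1 - 4 * d2.n) ≠ 0 := (map_ne_zero _).2 hd
  have hroot : ((algebraMap F K2 (r - 2 * d2.n) + algebraMap F K2 (1 - 2 * r) * d2.a) /
      algebraMap F K2 (1 - 4 * d2.n)) * ((algebraMap F K2 (r - 2 * d2.n) +
      algebraMap F K2 (1 - 2 * r) * d2.a) / algebraMap F K2 (1 - 4 * d2.n)) =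
      (algebraMap F K2 (r - 2 * d2.n) + algebraMap F K2 (1 - 2 * r) * d2.a) /
      algebraMap F K2 (1 - 4 * d2.n) - algebraMap F K2 d1.n := by
    have hr' := congrArg (algebraMap F K2) hr
    have hsq := d2.sq
    obtain ⟨D, hD⟩ : ∃ D, D = algebraMap F K2 (1 - 4 * d2.n) := ⟨_, rfl⟩
    rw [← hD] at hd' ⊢
    field_simp
    rw [hD]
    simp only [n3, map_add, map_sub, map_mul, map_one, map_ofNat, map_zero] at hr' ⊢
    linear_combination (1 - 2 * algebraMap F K2 r) ^ 2 * hsq +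
      (1 - 4 * algebraMap F K2 d2.n) * hr'
  obtain ⟨f, -⟩ := d1.lift _ hroot
  have : FiniteDimensional F K1 := Module.finite_of_finrank_pos (by omega)
  have : FiniteDimensional F K2 := Module.finite_of_finrank_pos (by omega)
  have hinj : Function.Injective f.toLinearMap := f.toRingHom.injective
  have hsur := (LinearMap.injective_iff_surjective_of_finrank_eq_finrank (hK1.trans hK2.symm)).1 hinj
  exact hne.false (AlgEquiv.ofBijective f ⟨hinj, hsur⟩)

end Emb

section Quat

variable {F K1 K2 : Type u} [Field F] [Field K1] [Field K2] [Algebra F K1] [Algebra F K2]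
  {s1 : K1 ≃ₐ[F] K1} {s2 : K2 ≃ₐ[F] K2} (d1 : QData F K1 s1) (d2 : QData F K2 s2)

theorem isUnit_of_norm (u v : F) (h : u * u + u * v + n3 d1 d2 * v * v ≠ 0) :
    IsUnit (algebraMap F (fixedK3 s1 s2) u + algebraMap F (fixedK3 s1 s2) v * eK d1 d2) := by
  have h1 : (algebraMap F (fixedK3 s1 s2) u + algebraMap F (fixedK3 s1 s2) v * eK d1 d2) *
      (algebraMap F (fixedK3 s1 s2) (u + v) - algebraMap F (fixedK3 s1 s2) v * eK d1 d2) =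
      algebraMap F (fixedK3 s1 s2) (u * u + u * v + n3 d1 d2 * v * v) := by
    simp only [map_add, map_mul]
    linear_combination -algebraMap F (fixedK3 s1 s2) v * algebraMap F (fixedK3 s1 s2) v *
      eK_sq d1 d2
  apply isUnit_of_mul_isUnit_left (y := algebraMap F (fixedK3 s1 s2) (u + v) -
    algebraMap F (fixedK3 s1 s2) v * eK d1 d2)
  rw [h1]
  exact (IsUnit.mk0 _ h).map _

open QuaternionAlgebra in
theorem quat_central (c : F) (hc : c ≠ 0) :
    Algebra.IsCentral F (QuaternionAlgebra F (-d1.n) 1 c) := by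
  constructor
  intro x hx
  rw [Subalgebra.mem_center_iff] at hx
  have hi := hx ⟨0, 1, 0, 0⟩
  have hj := hx ⟨0, 0, 1, 0⟩
  obtain ⟨x0, x1, x2, x3⟩ := x
  simp only [mk_mul_mk, QuaternionAlgebra.mk.injEq] at hi hj
  obtain ⟨-, -, i3, i4⟩ := hi
  obtain ⟨j1, j2, j3, j4⟩ := hj
  have hd := d1.disc
  have e2 : x2 = 0 := by
    have : (1 - 4 * d1.n) * x2 = 0 := by linear_combination -i3 - 2 * d1.n * i4
    exact (mul_eq_zero.1 this).resolve_left hd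
  have e3 : x3 = 0 := by
    have : (1 - 4 * d1.n) * x3 = 0 := by linear_combination i4 + 2 * i3
    exact (mul_eq_zero.1 this).resolve_left hd
  have e1 : x1 = 0 := by
    linear_combination j3
  subst e1 e2 e3
  exact Algebra.mem_bot.2 ⟨x0, rfl⟩

open QuaternionAlgebra in
theorem quat_simple (c : F) (hc : c ≠ 0) :
    IsSimpleRing (QuaternionAlgebra F (-d1.n) 1 c) := by
  apply IsSimpleRing.of_eq_bot_or_eq_top
  intro I
  by_cases hI : I = ⊥
  · exact Or.inl hI
  right
  have hunit : ∀ p q : F, (⟨p, q, 0, 0⟩ : QuaternionAlgebra F (-d1.n) 1 c) ∈ I →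
      (p ≠ 0 ∨ q ≠ 0) → I = ⊤ := by
    intro p q hm hpq
    have hN : p * p + p * q + d1.n * q * q ≠ 0 := by
      intro h
      have := d1.aniso p q h
      tauto
    obtain ⟨N, hNd⟩ : ∃ N, N = p * p + p * q + d1.n * q * q := ⟨_, rfl⟩
    rw [← hNd] at hN
    rw [← TwoSidedIdeal.one_mem_iff]
    have h1 := I.mul_mem_right _ (⟨(p + q) / N, -q / N, 0, 0⟩ : QuaternionAlgebra F (-d1.n) 1 c) hm
    convert h1 using 1
    have e1 : (1 : QuaternionAlgebra F (-d1.n) 1 c) = ⟨1, 0, 0, 0⟩ := rfl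
    rw [e1, mk_mul_mk]
    ext
    · simp only []
      field_simp
      linear_combination hNd
    · simp only []
      field_simp
      ring
    · simp
    · simp
  obtain ⟨x, hx, hx0⟩ : ∃ x, x ∈ I ∧ x ≠ 0 := by
    by_contra! h
    apply hI
    apply TwoSidedIdeal.ext
    intro x
    rw [TwoSidedIdeal.mem_bot]
    exact ⟨h x, fun h => h ▸ I.zero_mem⟩
  obtain ⟨x0, x1, x2, x3⟩ := x
  by_cases h23 : x2 = 0 ∧ x3 = 0
  · obtain ⟨rfl, rfl⟩ := h23
    apply hunit x0 x1 hx
    by_contra! h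
    apply hx0
    rw [h.1, h.2]
    rfl
  · have hm : (⟨-1, 2, 0, 0⟩ : QuaternionAlgebra F (-d1.n) 1 c) *
        ((⟨0, 1, 0, 0⟩ : QuaternionAlgebra F (-d1.n) 1 c) * ⟨x0, x1, x2, x3⟩ -
        (⟨x0, x1, x2, x3⟩ : QuaternionAlgebra F (-d1.n) 1 c) * ⟨0, 1, 0, 0⟩) *
        (⟨0, 0, 1, 0⟩ : QuaternionAlgebra F (-d1.n) 1 c) ∈ I :=
      I.mul_mem_right _ _ (I.mul_mem_left _ _ (I.sub_mem (I.mul_mem_left _ _ hx)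
        (I.mul_mem_right _ _ hx)))
    have he : (⟨-1, 2, 0, 0⟩ : QuaternionAlgebra F (-d1.n) 1 c) *
        ((⟨0, 1, 0, 0⟩ : QuaternionAlgebra F (-d1.n) 1 c) * ⟨x0, x1, x2, x3⟩ -
        (⟨x0, x1, x2, x3⟩ : QuaternionAlgebra F (-d1.n) 1 c) * ⟨0, 1, 0, 0⟩) *
        (⟨0, 0, 1, 0⟩ : QuaternionAlgebra F (-d1.n) 1 c) =
        ⟨(1 - 4 * d1.n) * c * x2, (1 - 4 * d1.n) * c * x3, 0, 0⟩ := by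
      simp only [mk_mul_mk, mk_sub_mk]
      ext
      · simp only []
        ring
      · simp only []
        ring
      · simp only []
        ring
      · simp only []
        ring
    rw [he] at hm
    apply hunit _ _ hm
    have hd := mul_ne_zero d1.disc hc
    by_cases h2 : x2 = 0
    · right
      exact mul_ne_zero hd (fun h => h23 ⟨h2, h⟩)
    · left
      exact mul_ne_zero hd h2

open QuaternionAlgebra in
theorem exists_emb (hK1 : Module.finrank F K1 = 2) (hK2 : Module.finrank F K2 = 2)
    (u v : F) (huv : 2 * u + v = 1) (hN : u * u + u * v + n3 d1 d2 * v * v ≠ 0)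
    (ξ : fixedK3 s1 s2) (hξ : ξ = algebraMap F (fixedK3 s1 s2) u +
      algebraMap F (fixedK3 s1 s2) v * eK d1 d2) :
    ∃ E : QuaternionEmbedding F K1 K2, E.Regular ∧ E.IsInvariant s1 s2 ξ := by
  obtain ⟨p, hp⟩ : ∃ p : F, p = 1 - 2 * d2.n - u * (1 - 4 * d2.n) := ⟨_, rfl⟩
  obtain ⟨c, hc⟩ : ∃ c : F, c = p * p + p * (1 - 2 * p) + d1.n * (1 - 2 * p) * (1 - 2 * p) - d2.n :=
    ⟨_, rfl⟩
  have hv : v = 1 - 2 * u := by linear_combination huv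
  have hc0 : c ≠ 0 := by
    have : c = (1 - 4 * d2.n) * (u * u + u * v + n3 d1 d2 * v * v) := by
      rw [hc, hp, n3, hv]
      ring
    rw [this]
    exact mul_ne_zero d2.disc hN
  let A : QuaternionAlgebra F (-d1.n) 1 c := ⟨0, 1, 0, 0⟩
  let b : QuaternionAlgebra F (-d1.n) 1 c := ⟨p, 1 - 2 * p, 1, 0⟩
  obtain ⟨f1, hf1⟩ := d1.lift A (by
    simp only [A, mk_mul_mk, algebraMap_eq, mk_sub_mk]
    ext <;> simp)
  obtain ⟨f2, hf2⟩ := d2.lift b (by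
    simp only [b, mk_mul_mk, algebraMap_eq, mk_sub_mk]
    ext
    · simp only []
      rw [hc]
      ring
    · simp only []
      ring
    · simp only []
      ring
    · simp only []
      ring)
  let E : QuaternionEmbedding F K1 K2 :=
    { B := QuaternionAlgebra F (-d1.n) 1 c
      central := quat_central d1 c hc0
      simple := quat_simple d1 c hc0
      dim4 := finrank_eq_four _ _ _
      α1 := f1
      α2 := f2 }
  refine ⟨E, ?_, ?_⟩
  · change Algebra.adjoin F (Set.range f1 ∪ Set.range f2) = ⊤
    rw [eq_top_iff]
    rintro ⟨z0, z1, z2, z3⟩ -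
    have hA : A ∈ Algebra.adjoin F (Set.range f1 ∪ Set.range f2) :=
      Algebra.subset_adjoin (Or.inl ⟨d1.a, hf1⟩)
    have hb : b ∈ Algebra.adjoin F (Set.range f1 ∪ Set.range f2) :=
      Algebra.subset_adjoin (Or.inr ⟨d2.a, hf2⟩)
    have hj : (⟨0, 0, 1, 0⟩ : QuaternionAlgebra F (-d1.n) 1 c) ∈
        Algebra.adjoin F (Set.range f1 ∪ Set.range f2) := by
      have : (⟨0, 0, 1, 0⟩ : QuaternionAlgebra F (-d1.n) 1 c) =
          b - algebraMap F _ p - (1 - 2 * p) • A := by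
        simp only [A, b, algebraMap_eq, mk_sub_mk, smul_mk]
        ext <;> simp
      rw [this]
      exact sub_mem (sub_mem hb (Subalgebra.algebraMap_mem _ _)) (Subalgebra.smul_mem _ hA _)
    have : (⟨z0, z1, z2, z3⟩ : QuaternionAlgebra F (-d1.n) 1 c) =
        algebraMap F _ z0 + z1 • A + z2 • (⟨0, 0, 1, 0⟩ : QuaternionAlgebra F (-d1.n) 1 c) +
        z3 • (A * ⟨0, 0, 1, 0⟩) := by
      simp only [A, algebraMap_eq, mk_mul_mk, mk_add_mk, smul_mk]
      ext <;> simp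
    rw [this]
    exact add_mem (add_mem (add_mem (Subalgebra.algebraMap_mem _ _) (Subalgebra.smul_mem _ hA _))
      (Subalgebra.smul_mem _ hj _)) (Subalgebra.smul_mem _ (mul_mem hA hj) _)
  · refine ⟨fun z : QuaternionAlgebra F (-d1.n) 1 c => star z,
      fun z : QuaternionAlgebra F (-d1.n) 1 c => (z * star z).re, fun a b => star_add a b,
      fun a b => star_mul a b, fun a => star_star a, fun c => star_coe c,
      fun z => (mul_star_eq_coe z).symm, ?_⟩
    intro x h
    obtain ⟨x0, x1, x2, x3, hx⟩ := tspan d1 d2 x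
    rw [trace_norm d1 d2 hK1 hK2 u v x0 x1 x2 x3 x hx _ _ rfl rfl ξ hξ h]
    have hm : E.mulMap x = lin A b x0 x1 x2 x3 := by
      rw [hx, mulMap_lin]
      change lin (f1 d1.a) (f2 d2.a) x0 x1 x2 x3 = _
      rw [hf1, hf2]
    have hl : lin A b x0 x1 x2 x3 = (⟨x0 + x2 * p - d1.n * x3 * (1 - 2 * p),
        x1 + x2 * (1 - 2 * p) + x3 * (p + (1 - 2 * p)), x2, x3⟩ :
        QuaternionAlgebra F (-d1.n) 1 c) := by
      have e1 : (1 : QuaternionAlgebra F (-d1.n) 1 c) = ⟨1, 0, 0, 0⟩ := rfl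
      simp only [lin, A, b, e1, mk_mul_mk, mk_add_mk, smul_mk, smul_eq_mul]
      ext
      · simp only []
        ring
      · simp only []
        ring
      · simp only []
        ring
      · simp only []
        ring
    rw [hm, hl]
    simp only [star_mk, mk_mul_mk, n3]
    rw [hc, hp, hv]
    ring

end Quat

end Helpers

/-- Let `K1 ≇ K2` be quadratic field extensions of `F` inside the
biquadratic algebra `K = K1 ⊗[F] K2`, with `K3` the third quadratic subextension (the fixed
algebra of `τ3 = σ1 ⊗ σ2`).  The invariant map is a bijection between isomorphism classes of
regular quaternion embeddings of `(K1, K2)` and `{ξ ∈ K3^× : Tr_{K3/F} ξ = 1}`:  the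
invariant of a regular embedding is a unit of trace one; two regular embeddings are
isomorphic iff they have the same invariant; and every trace-one unit arises. -/
theorem stmt5 (F K1 K2 : Type u) [Field F] [Field K1] [Field K2]
    [Algebra F K1] [Algebra F K2]
    (hK1 : Module.finrank F K1 = 2) (hK2 : Module.finrank F K2 = 2)
    (hne : IsEmpty (K1 ≃ₐ[F] K2))
    (σ1 : K1 ≃ₐ[F] K1) (σ2 : K2 ≃ₐ[F] K2)
    (hσ1 : Function.Involutive σ1) (hσ2 : Function.Involutive σ2)
    (hσ1ne : σ1 ≠ AlgEquiv.refl) (hσ2ne : σ2 ≠ AlgEquiv.refl) :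
    -- the invariant of a regular embedding is a trace-one unit
    (∀ (E : QuaternionEmbedding F K1 K2) (ξ : fixedK3 σ1 σ2),
        E.Regular → E.IsInvariant σ1 σ2 ξ →
        IsUnit ξ ∧ Algebra.trace F (fixedK3 σ1 σ2) ξ = 1) ∧
    -- injectivity on isomorphism classes
    (∀ (E E' : QuaternionEmbedding F K1 K2) (ξ ξ' : fixedK3 σ1 σ2),
        E.Regular → E'.Regular → E.IsInvariant σ1 σ2 ξ → E'.IsInvariant σ1 σ2 ξ' →
        (E.Isomorphic E' ↔ ξ = ξ')) ∧
    -- surjectivity onto trace-one units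
    (∀ ξ : fixedK3 σ1 σ2, IsUnit ξ → Algebra.trace F (fixedK3 σ1 σ2) ξ = 1 →
        ∃ E : QuaternionEmbedding F K1 K2, E.Regular ∧ E.IsInvariant σ1 σ2 ξ) := by
  obtain ⟨d1⟩ := quad_exists F K1 hK1 σ1 hσ1 hσ1ne
  obtain ⟨d2⟩ := quad_exists F K2 hK2 σ2 hσ2 hσ2ne
  refine ⟨?_, ?_, ?_⟩
  · intro E ξ hE hξ
    obtain ⟨u, v, huv⟩ := eK_span d1 d2 hK1 hK2 ξ
    obtain ⟨h1, -⟩ := inv_relation d1 d2 hK1 hK2 E u v ξ huv hξ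
    refine ⟨?_, by rw [huv, trace_eK d1 d2 hK1 hK2, h1]⟩
    rw [huv]
    exact isUnit_of_norm d1 d2 u v (norm_ne_zero d1 d2 hK1 hK2 hne u v h1)
  · intro E E' ξ ξ' hE hE' hξ hξ'
    obtain ⟨u, v, huv⟩ := eK_span d1 d2 hK1 hK2 ξ
    obtain ⟨u', v', huv'⟩ := eK_span d1 d2 hK1 hK2 ξ'
    obtain ⟨h1, h2⟩ := inv_relation d1 d2 hK1 hK2 E u v ξ huv hξ
    obtain ⟨h1', h2'⟩ := inv_relation d1 d2 hK1 hK2 E' u' v' ξ' huv' hξ'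
    constructor
    · rintro ⟨e, e1, e2⟩
      have h3 := congrArg e h2
      simp only [map_mul, map_add, map_sub, e1, e2, AlgEquiv.commutes] at h3
      rw [h2'] at h3
      have := nontriv E'
      have h4 := (algebraMap F E'.B).injective (sub_right_injective h3)
      obtain ⟨rfl, rfl⟩ := TT_inj d1 d2 u' v' u v h1' h1 h4
      rw [huv, huv']
    · rintro rfl
      have h3 := trace_eK d1 d2 hK1 hK2 (u - u') (v - v')
      have h4 := eK_indep d1 d2 hK1 hK2 (u - u') (v - v') (by
        have h5 := huv.symm.trans huv'
        simp only [map_sub]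
        linear_combination h5)
      have hu : u = u' := sub_eq_zero.1 h4.1
      have hv : v = v' := sub_eq_zero.1 h4.2
      subst hu hv
      exact iso_of_eq d1 d2 hK1 hK2 E E' hE hE' _ h2 h2'
  · intro ξ _ htr
    obtain ⟨u, v, huv⟩ := eK_span d1 d2 hK1 hK2 ξ
    rw [huv, trace_eK d1 d2 hK1 hK2] at htr
    exact exists_emb d1 d2 hK1 hK2 u v htr (norm_ne_zero d1 d2 hK1 hK2 hne u v htr) ξ huv
end
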